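/- Let 0<α<1, a∈ℝ, and let τ₁, τ₂ be continuous and bounded on (0,+∞). Define w₁(x,t)=∫₀^t G_α^{2α/3}(x−a,t−η)τ₁(η)dη for x≠a, t>0, and w₂(x,t)=∫₀^t V_α^{2α/3}(x−a,t−η)τ₂(η)dη for x>a, t>0. Then: (1) w₁ satisfies D^α_{0,t}w₁(x,t) − ∂³w₁/∂x³(x,t) = 0 for every x≠a and t>0, and w₂ satisfies the same equation for every x>a and t>0; (2) lim_{t→0⁺} w₁(x,t)=0 for every x≠a and lim_{t→0⁺} w₂(x,t)=0 for every x>a. -/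

import Mathlib

open MeasureTheory Real Filter Set Topology

/-- Caputo fractional derivative of order `α` with base point `0`. -/
noncomputable def caputoD (α : ℝ) (g : ℝ → ℝ) (t : ℝ) : ℝ :=
  (1 / Real.Gamma (1 - α)) * ∫ ξ in (0:ℝ)..t, deriv g ξ / (t - ξ) ^ α

/-- Riemann–Liouville fractional integral of order `β` with base point `0`. -/
noncomputable def fracJ (β : ℝ) (g : ℝ → ℝ) (t : ℝ) : ℝ :=
  (1 / Real.Gamma β) * ∫ ξ in (0:ℝ)..t, g ξ * (t - ξ) ^ (β - 1)

/-- The Wright function `φ(λ, μ; z)`. -/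
noncomputable def wrightPhi (l μ z : ℂ) : ℂ :=
  ∑' n : ℕ, z ^ n / ((n.factorial : ℂ) * Complex.Gamma (l * n + μ))

/-- The cube root of unity `e^{2πi/3}`. -/
noncomputable def e23 : ℂ := Complex.exp (2 * Real.pi * Complex.I / 3)

/-- First fundamental solution `G_α^μ(x,t)` of the time-fractional Airy equation. -/
noncomputable def Gfun (α μ : ℝ) (x t : ℝ) : ℝ :=
  if x < 0 then
    (1/3) * t ^ (μ - 1) * (wrightPhi (-(α/3)) μ ((x / t ^ (α/3) : ℝ) : ℂ)).re
  else
    -(2/3) * t ^ (μ - 1) * (e23 * wrightPhi (-(α/3)) μ (e23 * ((x / t ^ (α/3) : ℝ) : ℂ))).re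

/-- Second fundamental solution `V_α^μ(x,t)` of the time-fractional Airy equation. -/
noncomputable def Vfun (α μ : ℝ) (x t : ℝ) : ℝ :=
  (1/3) * t ^ (μ - 1) * (e23 * wrightPhi (-(α/3)) μ (e23 * ((x / t ^ (α/3) : ℝ) : ℂ))).im

/-- `G_α^μ` extended across `x = 0` by its common one-sided limit. -/
noncomputable def Ghat (α μ : ℝ) (x t : ℝ) : ℝ :=
  if x = 0 then t ^ (μ - 1) / (3 * Real.Gamma μ) else Gfun α μ x t


/-! ### Geometry of the cut region -/

structure GoodB (b : ℂ) (ρ ε κ : ℝ) : Prop where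
  ρpos : 0 < ρ
  ρlt : ρ < 1/2
  εpos : 0 < ε
  εle : ε ≤ 1/2
  κpos : 0 < κ
  bound : ∀ s : ℂ, s ≠ 0 → -ε * ‖s‖ ≤ s.re → κ * ‖s‖ ^ ρ ≤ (b * s ^ (ρ:ℂ)).re

def Reg (ε : ℝ) (s : ℂ) : Prop := 1/2 ≤ ‖s‖ ∧ -ε * ‖s‖ ≤ s.re

lemma Reg.ne_zero {ε : ℝ} {s : ℂ} (h : Reg ε s) : s ≠ 0 := by
  rintro rfl
  have := h.1
  norm_num at this

lemma Reg.slit {ε : ℝ} (hε : ε ≤ 1/2) {s : ℂ} (h : Reg ε s) : s ∈ Complex.slitPlane := by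
  rw [Complex.mem_slitPlane_iff]
  by_contra! hc
  have h1 : ‖s‖ = -s.re := by
    have : s = (s.re : ℂ) := Complex.ext rfl (by simp [hc.2])
    rw [this, Complex.norm_real, Real.norm_eq_abs, abs_of_nonpos hc.1]; simp
  have h2 := h.1
  have h3 := h.2
  nlinarith

lemma goodB_exists (B ρ : ℝ) (hB : |B| ≤ π/3) (hρ : 0 < ρ) (hρ' : ρ < 1/3) :
    ∃ ε κ, GoodB (Complex.exp (B * Complex.I)) ρ ε κ := by
  have hpi := Real.pi_pos
  set g := π/6 - ρ * (π/2) with hg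
  have hg0 : 0 < g := by rw [hg]; nlinarith
  have hg1 : g < π/6 := by rw [hg]; nlinarith
  refine ⟨Real.sin g, Real.sin (2*g/3), hρ, by linarith, ?_, ?_, ?_, ?_⟩
  · exact Real.sin_pos_of_pos_of_lt_pi hg0 (by linarith)
  · rw [← Real.sin_pi_div_six]
    exact (Real.sin_lt_sin_of_lt_of_le_pi_div_two (by linarith) (by linarith) hg1).le
  · exact Real.sin_pos_of_pos_of_lt_pi (by linarith) (by linarith)
  · intro s hs hre
    have hns : 0 < ‖s‖ := norm_pos_iff.mpr hs
    have harg : |s.arg| ≤ π/2 + g := by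
      by_contra! hc
      have h1 : Real.cos |s.arg| < Real.cos (π/2 + g) :=
        Real.cos_lt_cos_of_nonneg_of_le_pi (by linarith) (Complex.abs_arg_le_pi s) hc
      rw [Real.cos_abs, Complex.cos_arg hs, add_comm, Real.cos_add_pi_div_two, div_lt_iff₀ hns] at h1
      linarith
    have hA : |B + ρ * s.arg| ≤ π/2 - 2*g/3 := by
      calc |B + ρ * s.arg| ≤ |B| + |ρ * s.arg| := abs_add_le _ _
        _ = |B| + ρ * |s.arg| := by rw [abs_mul, abs_of_pos hρ]
        _ ≤ π/3 + ρ * (π/2 + g) := by gcongr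
        _ ≤ _ := by rw [hg] at *; nlinarith
    have hcos : Real.sin (2*g/3) ≤ Real.cos (B + ρ * s.arg) := by
      rw [← Real.cos_pi_div_two_sub, ← Real.cos_abs (B + ρ * s.arg)]
      exact Real.cos_le_cos_of_nonneg_of_le_pi (abs_nonneg _) (by linarith) hA
    have hre : (Complex.exp (B * Complex.I) * s ^ (ρ:ℂ)).re = ‖s‖ ^ ρ * Real.cos (B + ρ * s.arg) := by
      rw [Complex.cpow_def_of_ne_zero hs, ← Complex.exp_add, Complex.exp_re]
      congr 1
      · rw [Real.rpow_def_of_pos hns]; congr 1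
        simp [Complex.log_re]
      · congr 1; simp [Complex.log_im, mul_comm]
    rw [hre, mul_comm]
    gcongr

/-! ### The integrand -/

noncomputable def Fk (b : ℂ) (ρ μ r t : ℝ) (s : ℂ) : ℂ :=
  Complex.exp (s * t) * (s ^ (-(μ:ℂ)) * Complex.exp (-(b * r * s ^ (ρ:ℂ))))

def DecayB (b : ℂ) (ρ ε μ r C : ℝ) : Prop :=
  ∀ s : ℂ, Reg ε s → ‖s ^ (-(μ:ℂ)) * Complex.exp (-(b * r * s ^ (ρ:ℂ)))‖ ≤ C * (‖s‖^4)⁻¹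

lemma norm_cpow_neg_real (s : ℂ) (μ : ℝ) : ‖s ^ (-(μ:ℂ))‖ = ‖s‖ ^ (-μ) := by
  rw [← Complex.ofReal_neg, Complex.norm_cpow_real]

lemma rpow_neg_le_half {u p : ℝ} (hu : 1/2 ≤ u) (hp : p ≤ 0) : u ^ p ≤ (1/2:ℝ) ^ p :=
  Real.rpow_le_rpow_of_nonpos (by norm_num) hu hp

lemma decay_pos {b : ℂ} {ρ ε κ : ℝ} (hb : GoodB b ρ ε κ) (μ : ℝ) {r0 : ℝ} (hr0 : 0 < r0) :
    ∃ C, 0 ≤ C ∧ ∀ r, r0 ≤ r → DecayB b ρ ε μ r C := by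
  obtain ⟨m, hm⟩ := exists_nat_ge ((4 - μ) / ρ)
  rw [div_le_iff₀ hb.ρpos] at hm
  refine ⟨(1/2:ℝ) ^ (4 - μ - m * ρ) * (m.factorial / (κ * r0)^m), ?_, ?_⟩
  · have := hb.κpos; positivity
  intro r hr s hs
  have hκ := hb.κpos
  have hn : 0 < ‖s‖ := norm_pos_iff.mpr hs.ne_zero
  have hrp : 0 < r := by linarith
  rw [norm_mul, norm_cpow_neg_real, Complex.norm_exp]
  have h1 : (-(b * r * s ^ (ρ:ℂ))).re ≤ -(κ * r0 * ‖s‖ ^ ρ) := by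
    have h2 := hb.bound s hs.ne_zero hs.2
    have h3 : (b * r * s ^ (ρ:ℂ)).re = r * (b * s ^ (ρ:ℂ)).re := by
      rw [mul_comm b, mul_assoc, Complex.re_ofReal_mul]
    rw [Complex.neg_re, h3]
    have h4 : 0 ≤ κ * ‖s‖ ^ ρ := by positivity
    nlinarith
  have h5 : Real.exp ((-(b * r * s ^ (ρ:ℂ))).re) ≤ m.factorial / (κ * r0 * ‖s‖ ^ ρ)^m := by
    refine (Real.exp_le_exp.mpr h1).trans ?_
    rw [Real.exp_neg]
    have h6 := Real.pow_div_factorial_le_exp (κ * r0 * ‖s‖ ^ ρ) (by positivity) m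
    rw [inv_le_comm₀ (Real.exp_pos _) (by positivity), inv_div]
    exact h6
  calc ‖s‖ ^ (-μ) * Real.exp ((-(b * r * s ^ (ρ:ℂ))).re)
      ≤ ‖s‖ ^ (-μ) * (m.factorial / (κ * r0 * ‖s‖ ^ ρ)^m) := by gcongr
    _ = ‖s‖ ^ (4 - μ - m * ρ) * (m.factorial / (κ * r0)^m) * (‖s‖^4)⁻¹ := by
        have e1 : ‖s‖ ^ (4 - μ - m * ρ) = ‖s‖ ^ 4 * ‖s‖ ^ (-μ) * ((‖s‖ ^ ρ) ^ m)⁻¹ := by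
          rw [← Real.rpow_natCast (‖s‖ ^ ρ), ← Real.rpow_mul hn.le, ← Real.rpow_neg hn.le,
            ← Real.rpow_natCast ‖s‖ 4, ← Real.rpow_add hn, ← Real.rpow_add hn]
          congr 1; push_cast; ring
        rw [e1, mul_pow]
        field_simp
    _ ≤ _ := by
        gcongr ?_ * _ * _
        exact rpow_neg_le_half hs.1 (by linarith)

lemma decay_zero (b : ℂ) (ρ ε : ℝ) {μ : ℝ} (hμ : 4 ≤ μ) :
    DecayB b ρ ε μ 0 ((1/2:ℝ) ^ (4 - μ)) := by
  intro s hs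
  have hn : 0 < ‖s‖ := norm_pos_iff.mpr hs.ne_zero
  simp only [Complex.ofReal_zero, mul_zero, zero_mul, neg_zero, Complex.exp_zero, mul_one]
  rw [norm_cpow_neg_real]
  have : ‖s‖ ^ (-μ) = ‖s‖ ^ (4 - μ) * (‖s‖^4)⁻¹ := by
    rw [← Real.rpow_natCast ‖s‖ 4, ← Real.rpow_neg hn.le, ← Real.rpow_add hn]
    congr 1; push_cast; ring
  rw [this]
  gcongr ?_ * _
  exact rpow_neg_le_half hs.1 (by linarith)

lemma Fk_hasDerivAt (b : ℂ) (ρ μ r t : ℝ) {s : ℂ} (hs : s ∈ Complex.slitPlane) :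
    HasDerivAt (Fk b ρ μ r t)
      (t * Fk b ρ μ r t s - μ * Fk b ρ (μ+1) r t s - b * r * ρ * Fk b ρ (μ+1-ρ) r t s) s := by
  have hs0 : s ≠ 0 := Complex.slitPlane_ne_zero hs
  have h1 : HasDerivAt (fun s : ℂ => Complex.exp (s * t)) (Complex.exp (s * t) * t) s := by
    simpa using ((hasDerivAt_id s).mul_const (t:ℂ)).cexp
  have h2 : HasDerivAt (fun s : ℂ => s ^ (-(μ:ℂ))) (-μ * s ^ (-(μ:ℂ) - 1)) s := by
    simpa using (hasDerivAt_id s).cpow_const hs (c := -(μ:ℂ))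
  have h3 : HasDerivAt (fun s : ℂ => s ^ (ρ:ℂ)) (ρ * s ^ ((ρ:ℂ) - 1)) s := by
    simpa using (hasDerivAt_id s).cpow_const hs (c := (ρ:ℂ))
  have h4 := ((h3.const_mul (b * r)).neg).cexp
  refine (h1.mul (h2.mul h4)).congr_deriv ?_
  unfold Fk
  have e1 : s ^ (-((μ + 1 : ℝ):ℂ)) = s ^ (-(μ:ℂ) - 1) := by congr 1; push_cast; ring
  have e2 : s ^ (-((μ + 1 - ρ : ℝ):ℂ)) = s ^ (-(μ:ℂ)) * s ^ ((ρ:ℂ) - 1) := by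
    rw [← Complex.cpow_add _ _ hs0]; congr 1; push_cast; ring
  rw [e1, e2]
  simp only [Pi.mul_apply, Pi.neg_apply]
  ring

/-! ### Contour deformation -/

lemma one_add_abs_sq_le (ω : ℝ) : 1 + |ω| ≤ 2 * (1 + ω^2) := by
  have := sq_abs ω
  nlinarith [sq_nonneg (|ω| - 1), abs_nonneg ω]

lemma tendsto_one_add_sq_inv_top : Tendsto (fun ω : ℝ => (1 + ω^2)⁻¹) atTop (𝓝 0) := by
  apply Filter.Tendsto.inv_tendsto_atTop
  exact tendsto_atTop_add_const_left _ _ (tendsto_pow_atTop two_ne_zero)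

lemma tendsto_one_add_sq_inv_bot : Tendsto (fun ω : ℝ => (1 + ω^2)⁻¹) atBot (𝓝 0) := by
  have := tendsto_one_add_sq_inv_top.comp tendsto_neg_atBot_atTop
  refine this.congr (fun x => ?_)
  simp

lemma homotopy_const (F F' : ℂ → ℂ) (A A' g g' : ℝ → ℝ) (C : ℝ)
    (hA : ∀ θ, HasDerivAt A (A' θ) θ) (hA' : Continuous A')
    (hg : ∀ ω, HasDerivAt g (g' ω) ω) (hg' : Continuous g')
    (hgb : ∀ ω, |g ω| ≤ 1 + |ω|) (hgb' : ∀ ω, |g' ω| ≤ 1)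
    (hF : ∀ θ ω : ℝ, HasDerivAt F (F' (1 + ω * Complex.I + A θ * g ω)) (1 + ω * Complex.I + A θ * g ω))
    (hF'c : ∀ θ : ℝ, Continuous (fun ω : ℝ => F' (1 + ω * Complex.I + A θ * g ω)))
    (hFb : ∀ θ ω : ℝ, ‖F (1 + ω * Complex.I + A θ * g ω)‖ ≤ C * ((1 + ω^2)^2)⁻¹)
    (hFb' : ∀ θ ω : ℝ, ‖F' (1 + ω * Complex.I + A θ * g ω)‖ ≤ C * ((1 + ω^2)^2)⁻¹) (θ₁ θ₂ : ℝ) :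
    ∫ ω : ℝ, F (1 + ω * Complex.I + A θ₁ * g ω) * (Complex.I + A θ₁ * g' ω) =
    ∫ ω : ℝ, F (1 + ω * Complex.I + A θ₂ * g ω) * (Complex.I + A θ₂ * g' ω) := by
  have hgc : Continuous g := continuous_iff_continuousAt.mpr fun ω => (hg ω).continuousAt
  have hAc : Continuous A := continuous_iff_continuousAt.mpr fun ω => (hA ω).continuousAt
  have hC : 0 ≤ C := by
    have := (norm_nonneg _).trans (hFb 0 0)
    simpa using this
  have hγc : ∀ θ : ℝ, Continuous (fun ω : ℝ => 1 + ω * Complex.I + A θ * g ω : ℝ → ℂ) := by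
    intro θ; fun_prop
  have hFc : ∀ θ : ℝ, Continuous (fun ω : ℝ => F (1 + ω * Complex.I + A θ * g ω)) := by
    intro θ
    rw [continuous_iff_continuousAt]
    intro ω
    exact ContinuousAt.comp (f := fun ω : ℝ => (1 + ω * Complex.I + A θ * g ω : ℂ))
      (hF θ ω).continuousAt (hγc θ).continuousAt
  have hIc : ∀ θ : ℝ, Continuous (fun ω : ℝ => (Complex.I + A θ * g' ω : ℂ)) := by
    intro θ; fun_prop
  -- derivative in ω of F(γ) g
  have hdω : ∀ θ ω : ℝ, HasDerivAt (fun ω : ℝ => F (1 + ω * Complex.I + A θ * g ω) * g ω)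
      (F' (1 + ω * Complex.I + A θ * g ω) * (Complex.I + A θ * g' ω) * g ω
        + F (1 + ω * Complex.I + A θ * g ω) * g' ω) ω := by
    intro θ ω
    have h1 : HasDerivAt (fun ω : ℝ => (1 + ω * Complex.I + A θ * g ω : ℂ)) (Complex.I + A θ * g' ω) ω := by
      have := ((Complex.ofRealCLM.hasDerivAt (x := ω)).mul_const Complex.I).const_add (1:ℂ)
      have h2 := (hg ω).ofReal_comp.const_mul (A θ : ℂ)
      exact (this.add h2).congr_deriv (by simp)
    have h3 := (hF θ ω).comp ω h1
    exact h3.mul (hg ω).ofReal_comp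
  have hdθ : ∀ θ ω : ℝ, HasDerivAt (fun θ : ℝ => F (1 + ω * Complex.I + A θ * g ω) * (Complex.I + A θ * g' ω))
      (A' θ * (F' (1 + ω * Complex.I + A θ * g ω) * (Complex.I + A θ * g' ω) * g ω
        + F (1 + ω * Complex.I + A θ * g ω) * g' ω)) θ := by
    intro θ ω
    have h1 : HasDerivAt (fun θ : ℝ => (1 + ω * Complex.I + A θ * g ω : ℂ)) (A' θ * g ω) θ :=
      ((hA θ).ofReal_comp.mul_const (g ω : ℂ)).const_add _
    have h2 : HasDerivAt (fun θ : ℝ => (Complex.I + A θ * g' ω : ℂ)) (A' θ * g' ω) θ :=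
      ((hA θ).ofReal_comp.mul_const (g' ω : ℂ)).const_add _
    have h3 := (hF θ ω).comp θ h1
    refine (h3.mul h2).congr_deriv ?_
    simp only [Function.comp]; ring
  have hI : ∀ θ ω : ℝ, ‖(Complex.I + A θ * g' ω : ℂ)‖ ≤ 1 + |A θ| := by
    intro θ ω
    refine (norm_add_le _ _).trans ?_
    simp only [Complex.norm_I, norm_mul, Complex.norm_real, Real.norm_eq_abs]
    have := hgb' ω
    nlinarith [abs_nonneg (A θ)]
  have hbd : ∀ θ ω : ℝ, ‖F' (1 + ω * Complex.I + A θ * g ω) * (Complex.I + A θ * g' ω) * g ω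
        + F (1 + ω * Complex.I + A θ * g ω) * g' ω‖ ≤ (2 * C * (1 + |A θ|) + C) * (1 + ω^2)⁻¹ := by
    intro θ ω
    have hp : 0 < 1 + ω^2 := by positivity
    have e : ((1 + ω^2)^2)⁻¹ * (1 + ω^2) = (1 + ω^2)⁻¹ := by field_simp
    have e' : ((1 + ω^2)^2)⁻¹ ≤ (1 + ω^2)⁻¹ := by
      apply inv_anti₀ hp; nlinarith [sq_nonneg ω]
    have k1 := hFb θ ω
    have k2 := hFb' θ ω
    have k3 : |g ω| ≤ 2 * (1 + ω^2) := (hgb ω).trans (one_add_abs_sq_le ω)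
    refine (norm_add_le _ _).trans ?_
    simp only [norm_mul, Complex.norm_real, Real.norm_eq_abs]
    calc _ ≤ (C * ((1 + ω^2)^2)⁻¹) * (1 + |A θ|) * (2 * (1 + ω^2)) + (C * ((1 + ω^2)^2)⁻¹) * 1 := by
          gcongr
          · exact hI θ ω
          · exact hgb' ω
      _ = 2 * C * (1 + |A θ|) * (((1 + ω^2)^2)⁻¹ * (1 + ω^2)) + C * ((1 + ω^2)^2)⁻¹ := by ring
      _ ≤ 2 * C * (1 + |A θ|) * (1 + ω^2)⁻¹ + C * (1 + ω^2)⁻¹ := by rw [e]; gcongr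
      _ = _ := by ring
  have hcont : ∀ θ : ℝ, Continuous (fun ω : ℝ => F' (1 + ω * Complex.I + A θ * g ω) * (Complex.I + A θ * g' ω) * g ω
        + F (1 + ω * Complex.I + A θ * g ω) * g' ω) := by
    intro θ
    have h1 := hF'c θ
    have h2 := hFc θ
    exact ((h1.mul (hIc θ)).mul (Complex.continuous_ofReal.comp hgc)).add
      (h2.mul (Complex.continuous_ofReal.comp hg'))
  have hint : ∀ θ : ℝ, Integrable (fun ω : ℝ => F' (1 + ω * Complex.I + A θ * g ω) * (Complex.I + A θ * g' ω) * g ω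
        + F (1 + ω * Complex.I + A θ * g ω) * g' ω) := by
    intro θ
    refine (integrable_inv_one_add_sq.const_mul (2 * C * (1 + |A θ|) + C)).mono'
      (hcont θ).aestronglyMeasurable (ae_of_all _ (hbd θ))
  have hzero : ∀ θ : ℝ, ∫ ω : ℝ, (F' (1 + ω * Complex.I + A θ * g ω) * (Complex.I + A θ * g' ω) * g ω
        + F (1 + ω * Complex.I + A θ * g ω) * g' ω) = 0 := by
    intro θ
    have hb : ∀ ω : ℝ, ‖F (1 + ω * Complex.I + A θ * g ω) * g ω‖ ≤ 2 * C * (1 + ω^2)⁻¹ := by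
      intro ω
      have hp : 0 < 1 + ω^2 := by positivity
      have e : ((1 + ω^2)^2)⁻¹ * (1 + ω^2) = (1 + ω^2)⁻¹ := by field_simp
      rw [norm_mul, Complex.norm_real, Real.norm_eq_abs]
      calc _ ≤ (C * ((1 + ω^2)^2)⁻¹) * (2 * (1 + ω^2)) := by
            gcongr
            · exact hFb θ ω
            · exact (hgb ω).trans (one_add_abs_sq_le ω)
        _ = 2 * C * (((1 + ω^2)^2)⁻¹ * (1 + ω^2)) := by ring
        _ = _ := by rw [e]
    have := integral_of_hasDerivAt_of_tendsto (m := 0) (n := 0) (hdω θ) (hint θ)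
      (squeeze_zero_norm hb (by simpa using tendsto_one_add_sq_inv_bot.const_mul (2*C)))
      (squeeze_zero_norm hb (by simpa using tendsto_one_add_sq_inv_top.const_mul (2*C)))
    simpa using this
  have hderiv : ∀ θ : ℝ, HasDerivAt (fun θ : ℝ => ∫ ω : ℝ, F (1 + ω * Complex.I + A θ * g ω) * (Complex.I + A θ * g' ω)) 0 θ := by
    intro θ
    obtain ⟨M, hM⟩ := (isCompact_closedBall θ 1).exists_bound_of_continuousOn hAc.continuousOn
    obtain ⟨M', hM'⟩ := (isCompact_closedBall θ 1).exists_bound_of_continuousOn hA'.continuousOn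
    have hM0 : 0 ≤ M := (norm_nonneg _).trans (hM θ (by simp))
    have hM0' : 0 ≤ M' := (norm_nonneg _).trans (hM' θ (by simp))
    have key := hasDerivAt_integral_of_dominated_loc_of_deriv_le (μ := volume) (x₀ := θ)
      (F := fun θ (ω:ℝ) => F (1 + ω * Complex.I + A θ * g ω) * (Complex.I + A θ * g' ω))
      (F' := fun θ (ω:ℝ) => (A' θ * (F' (1 + ω * Complex.I + A θ * g ω) * (Complex.I + A θ * g' ω) * g ω
        + F (1 + ω * Complex.I + A θ * g ω) * g' ω)))
      (bound := fun ω => M' * ((2 * C * (1 + M) + C) * (1 + ω^2)⁻¹))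
      (Metric.closedBall_mem_nhds θ one_pos) ?_ ?_ ?_ ?_ ?_ ?_
    · have h2 := key.2
      rw [integral_const_mul, hzero, mul_zero] at h2
      exact h2
    · refine Eventually.of_forall fun θ => ?_
      exact ((hFc θ).mul (hIc θ)).aestronglyMeasurable
    · refine (integrable_inv_one_add_sq.const_mul (C * (1 + |A θ|))).mono' ?_ (ae_of_all _ ?_)
      · exact ((hFc θ).mul (hIc θ)).aestronglyMeasurable
      · intro ω
        have hp : 0 < 1 + ω^2 := by positivity
        have e' : ((1 + ω^2)^2)⁻¹ ≤ (1 + ω^2)⁻¹ := by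
          apply inv_anti₀ hp; nlinarith [sq_nonneg ω]
        rw [norm_mul]
        calc _ ≤ (C * ((1 + ω^2)^2)⁻¹) * (1 + |A θ|) := by
              gcongr
              · exact hFb θ ω
              · exact hI θ ω
          _ ≤ (C * (1 + ω^2)⁻¹) * (1 + |A θ|) := by gcongr
          _ = _ := by ring
    · exact (continuous_const.mul (hcont θ)).aestronglyMeasurable
    · refine ae_of_all _ fun ω x hx => ?_
      rw [norm_mul, Complex.norm_real]
      have k1 := hM x hx
      have k2 := hM' x hx
      rw [Real.norm_eq_abs] at k1
      calc _ ≤ M' * ((2 * C * (1 + |A x|) + C) * (1 + ω^2)⁻¹) := by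
            gcongr
            exact hbd x ω
        _ ≤ _ := by gcongr
    · exact (integrable_inv_one_add_sq.const_mul _).const_mul _
    · exact ae_of_all _ fun ω x _ => hdθ x ω
  exact is_const_of_deriv_eq_zero (fun θ => (hderiv θ).differentiableAt) (fun θ => (hderiv θ).deriv) θ₁ θ₂

lemma Fk_bound {b : ℂ} {ρ ε μ r C t E ω : ℝ} {s : ℂ} (hd : DecayB b ρ ε μ r C) (hs : Reg ε s)
    (hC : 0 ≤ C) (hω : 1 + ω^2 ≤ 4 * ‖s‖^2) (hE : s.re * t ≤ E) :
    ‖Fk b ρ μ r t s‖ ≤ Real.exp E * (16 * C) * ((1 + ω^2)^2)⁻¹ := by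
  have hn : 0 < ‖s‖ := norm_pos_iff.mpr hs.ne_zero
  unfold Fk
  rw [norm_mul, Complex.norm_exp]
  have h1 : (s * (t:ℂ)).re = s.re * t := Complex.re_mul_ofReal _ _
  have h2 : (‖s‖^4)⁻¹ ≤ 16 * ((1 + ω^2)^2)⁻¹ := by
    rw [← div_eq_mul_inv, ← inv_div]
    apply inv_anti₀ (by positivity)
    have hp : 0 < 1 + ω^2 := by positivity
    nlinarith
  rw [h1]
  calc _ ≤ Real.exp E * (C * (‖s‖^4)⁻¹) := by
        gcongr
        exact hd s hs
    _ ≤ Real.exp E * (C * (16 * ((1 + ω^2)^2)⁻¹)) := by gcongr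
    _ = _ := by ring

lemma Fk_deform {b : ℂ} {ρ ε μ r t E : ℝ} {C₁ C₂ C₃ : ℝ} (hε : ε ≤ 1/2)
    (h1 : DecayB b ρ ε μ r C₁) (h2 : DecayB b ρ ε (μ+1) r C₂) (h3 : DecayB b ρ ε (μ+1-ρ) r C₃)
    (hC₁ : 0 ≤ C₁) (hC₂ : 0 ≤ C₂) (hC₃ : 0 ≤ C₃)
    (A A' g g' : ℝ → ℝ)
    (hA : ∀ θ, HasDerivAt A (A' θ) θ) (hA' : Continuous A')
    (hg : ∀ ω, HasDerivAt g (g' ω) ω) (hg' : Continuous g')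
    (hgb : ∀ ω, |g ω| ≤ 1 + |ω|) (hgb' : ∀ ω, |g' ω| ≤ 1)
    (hγ : ∀ θ ω : ℝ, Reg ε (1 + ω * Complex.I + A θ * g ω))
    (hγ2 : ∀ θ ω : ℝ, 1 + ω^2 ≤ 4 * ‖(1 + ω * Complex.I + A θ * g ω : ℂ)‖^2)
    (hγ3 : ∀ θ ω : ℝ, (1 + ω * Complex.I + A θ * g ω : ℂ).re * t ≤ E) (θ₁ θ₂ : ℝ) :
    ∫ ω : ℝ, Fk b ρ μ r t (1 + ω * Complex.I + A θ₁ * g ω) * (Complex.I + A θ₁ * g' ω) =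
    ∫ ω : ℝ, Fk b ρ μ r t (1 + ω * Complex.I + A θ₂ * g ω) * (Complex.I + A θ₂ * g' ω) := by
  have hgc : Continuous g := continuous_iff_continuousAt.mpr fun ω => (hg ω).continuousAt
  have hγc : ∀ θ : ℝ, Continuous (fun ω : ℝ => 1 + ω * Complex.I + A θ * g ω : ℝ → ℂ) := by
    intro θ; fun_prop
  have hFc : ∀ ν (θ : ℝ), Continuous (fun ω : ℝ => Fk b ρ ν r t (1 + ω * Complex.I + A θ * g ω)) := by
    intro ν θ
    rw [continuous_iff_continuousAt]
    intro ω
    exact ContinuousAt.comp (f := fun ω : ℝ => (1 + ω * Complex.I + A θ * g ω : ℂ))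
      (Fk_hasDerivAt b ρ ν r t ((hγ θ ω).slit hε)).continuousAt (hγc θ).continuousAt
  set D := 16 * C₁ + |t| * (16 * C₁) + |μ| * (16 * C₂) + ‖b * r * ρ‖ * (16 * C₃) with hD
  have hD0 : 16 * C₁ ≤ D := by
    rw [hD]
    have : 0 ≤ |t| * (16 * C₁) := by positivity
    have : 0 ≤ |μ| * (16 * C₂) := by positivity
    have : 0 ≤ ‖b * r * ρ‖ * (16 * C₃) := by positivity
    linarith
  refine homotopy_const (Fk b ρ μ r t) (fun s => t * Fk b ρ μ r t s - μ * Fk b ρ (μ+1) r t s - b * r * ρ * Fk b ρ (μ+1-ρ) r t s)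
    A A' g g' (Real.exp E * D) hA hA' hg hg' hgb hgb' ?_ ?_ ?_ ?_ θ₁ θ₂
  · intro θ ω
    exact Fk_hasDerivAt b ρ μ r t ((hγ θ ω).slit hε)
  · intro θ
    exact ((continuous_const.mul (hFc _ θ)).sub (continuous_const.mul (hFc _ θ))).sub
      (continuous_const.mul (hFc _ θ))
  · intro θ ω
    refine (Fk_bound h1 (hγ θ ω) hC₁ (hγ2 θ ω) (hγ3 θ ω)).trans ?_
    gcongr
  · intro θ ω
    have k1 := Fk_bound h1 (hγ θ ω) hC₁ (hγ2 θ ω) (hγ3 θ ω)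
    have k2 := Fk_bound h2 (hγ θ ω) hC₂ (hγ2 θ ω) (hγ3 θ ω)
    have k3 := Fk_bound h3 (hγ θ ω) hC₃ (hγ2 θ ω) (hγ3 θ ω)
    refine (norm_sub_le _ _).trans ((add_le_add_left (norm_sub_le _ _) _).trans ?_)
    rw [norm_mul, norm_mul (μ:ℂ), norm_mul (b * r * ρ), Complex.norm_real, Complex.norm_real,
      Real.norm_eq_abs, Real.norm_eq_abs]
    calc _ ≤ |t| * (Real.exp E * (16 * C₁) * ((1 + ω^2)^2)⁻¹) + |μ| * (Real.exp E * (16 * C₂) * ((1 + ω^2)^2)⁻¹)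
          + ‖b * r * ρ‖ * (Real.exp E * (16 * C₃) * ((1 + ω^2)^2)⁻¹) := by gcongr
      _ = Real.exp E * (D - 16 * C₁) * ((1 + ω^2)^2)⁻¹ := by rw [hD]; ring
      _ ≤ _ := by
        gcongr
        linarith

lemma vert_reg {ε : ℝ} (hε : 0 < ε) {σ : ℝ} (hσ : 1 ≤ σ) (ω : ℝ) :
    Reg ε ((σ:ℂ) + ω * Complex.I) ∧ σ^2 + ω^2 = ‖((σ:ℂ) + ω * Complex.I)‖^2 := by
  have hn : ‖((σ:ℂ) + ω * Complex.I)‖^2 = σ^2 + ω^2 := by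
    rw [← Complex.normSq_eq_norm_sq, Complex.normSq_add_mul_I]
  refine ⟨⟨?_, ?_⟩, hn.symm⟩
  · have : 0 ≤ ‖((σ:ℂ) + ω * Complex.I)‖ := norm_nonneg _
    nlinarith [sq_nonneg ω]
  · have : ((σ:ℂ) + ω * Complex.I).re = σ := by simp
    rw [this]
    have : 0 ≤ ‖((σ:ℂ) + ω * Complex.I)‖ := norm_nonneg _
    nlinarith

noncomputable def bent (ε ω : ℝ) : ℂ := 1 + ω * Complex.I + ε * ((1 - √(1 + ω^2) : ℝ) : ℂ)
noncomputable def bent' (ε ω : ℝ) : ℂ := Complex.I + ε * ((-(ω / √(1 + ω^2)) : ℝ) : ℂ)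

lemma sqrt_facts (ω : ℝ) : 1 ≤ √(1 + ω^2) ∧ √(1 + ω^2) ≤ 1 + |ω| ∧ |ω| ≤ √(1 + ω^2) := by
  refine ⟨?_, ?_, ?_⟩
  · rw [Real.one_le_sqrt]; nlinarith [sq_nonneg ω]
  · rw [Real.sqrt_le_left (by positivity)]; nlinarith [sq_abs ω, abs_nonneg ω]
  · rw [← Real.sqrt_sq_eq_abs]; apply Real.sqrt_le_sqrt; linarith

lemma bent_re (ε ω : ℝ) : (bent ε ω).re = 1 + ε * (1 - √(1 + ω^2)) := by
  simp only [bent, Complex.add_re, Complex.one_re, Complex.re_ofReal_mul, Complex.I_re,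
    Complex.ofReal_re, mul_zero, add_zero]

lemma bent_im (ε ω : ℝ) : (bent ε ω).im = ω := by
  simp only [bent, Complex.add_im, Complex.one_im, Complex.im_ofReal_mul, Complex.I_im,
    Complex.ofReal_im, mul_zero, add_zero, mul_one, zero_add]

lemma bent_reg {ε δ : ℝ} (hδ : 0 ≤ δ) (hδε : δ ≤ ε) (hε : ε ≤ 1/2) (ω : ℝ) :
    Reg ε (bent δ ω) ∧ 1 + ω^2 ≤ 4 * ‖bent δ ω‖^2 ∧ (bent δ ω).re ≤ 1 ∧ |ω| ≤ ‖bent δ ω‖ := by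
  obtain ⟨s1, s2, s3⟩ := sqrt_facts ω
  have hre := bent_re δ ω
  have him : |ω| ≤ ‖bent δ ω‖ := by
    have := Complex.abs_im_le_norm (bent δ ω)
    rwa [bent_im] at this
  have hre' := (le_abs_self _).trans (Complex.abs_re_le_norm (bent δ ω))
  have h0 := abs_nonneg ω
  have hn : 2/3 ≤ ‖bent δ ω‖ := by nlinarith
  have e : ω^2 = |ω|^2 := (sq_abs ω).symm
  refine ⟨⟨by linarith, ?_⟩, ?_, ?_, him⟩
  · rw [hre]; nlinarith
  · rw [e]; nlinarith
  · rw [hre]; nlinarith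

lemma hasDerivAt_g (ω : ℝ) : HasDerivAt (fun ω : ℝ => 1 - √(1 + ω^2)) (-(ω / √(1 + ω^2))) ω := by
  have hp : 1 + ω^2 ≠ 0 := by positivity
  have h1 : HasDerivAt (fun ω : ℝ => 1 + ω^2) (2 * ω) ω := by
    simpa using (hasDerivAt_pow 2 ω).const_add (1:ℝ)
  have h2 := (h1.sqrt hp).const_sub 1
  refine h2.congr_deriv ?_
  field_simp

lemma g'_bound (ω : ℝ) : |(-(ω / √(1 + ω^2)))| ≤ 1 := by
  obtain ⟨s1, s2, s3⟩ := sqrt_facts ω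
  rw [abs_neg, abs_div, abs_of_pos (by linarith : 0 < √(1 + ω^2))]
  exact div_le_one_of_le₀ s3 (by positivity)

lemma continuous_g' : Continuous (fun ω : ℝ => -(ω / √(1 + ω^2))) := by
  refine (Continuous.div continuous_id (by fun_prop) fun ω => ?_).neg
  have := (sqrt_facts ω).1
  linarith

lemma Fk_bend {b : ℂ} {ρ ε μ r t : ℝ} {C₁ C₂ C₃ : ℝ} (hε0 : 0 < ε) (hε : ε ≤ 1/2)
    (h1 : DecayB b ρ ε μ r C₁) (h2 : DecayB b ρ ε (μ+1) r C₂) (h3 : DecayB b ρ ε (μ+1-ρ) r C₃)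
    (hC₁ : 0 ≤ C₁) (hC₂ : 0 ≤ C₂) (hC₃ : 0 ≤ C₃) (ht : 0 ≤ t) :
    ∫ ω : ℝ, Fk b ρ μ r t (1 + ω * Complex.I) * Complex.I =
    ∫ ω : ℝ, Fk b ρ μ r t (bent ε ω) * bent' ε ω := by
  have hA : ∀ θ, 0 ≤ ε * Real.sin θ ^ 2 ∧ ε * Real.sin θ ^ 2 ≤ ε := fun θ =>
    ⟨by positivity, by nlinarith [Real.sin_sq_le_one θ]⟩
  have key := Fk_deform (b := b) (ρ := ρ) (μ := μ) (r := r) (t := t) (E := t) hε h1 h2 h3 hC₁ hC₂ hC₃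
    (fun θ => ε * Real.sin θ ^ 2) (fun θ => ε * (2 * Real.sin θ * Real.cos θ))
    (fun ω => 1 - √(1 + ω^2)) (fun ω => -(ω / √(1 + ω^2))) ?_ (by fun_prop) hasDerivAt_g
    continuous_g' ?_ g'_bound ?_ ?_ ?_ 0 (π/2)
  · simpa [bent, bent'] using key
  · intro θ
    have := ((Real.hasDerivAt_sin θ).pow 2).const_mul ε
    simpa using this
  · intro ω
    obtain ⟨s1, s2, s3⟩ := sqrt_facts ω
    rw [abs_le]; constructor <;> linarith
  · intro θ ω
    exact (bent_reg (hA θ).1 (hA θ).2 hε ω).1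
  · intro θ ω
    exact (bent_reg (hA θ).1 (hA θ).2 hε ω).2.1
  · intro θ ω
    have := (bent_reg (hA θ).1 (hA θ).2 hε ω).2.2.1
    have h := mul_le_mul_of_nonneg_right this ht
    rw [one_mul] at h
    exact h

lemma Fk_shift {b : ℂ} {ρ ε κ μ r t : ℝ} (hb : GoodB b ρ ε κ) (hr : 0 < r) (ht : t ≤ 0) :
    ∫ ω : ℝ, Fk b ρ μ r t (1 + ω * Complex.I) = 0 := by
  obtain ⟨C₁, hC₁, h1⟩ := decay_pos hb μ hr
  obtain ⟨C₂, hC₂, h2⟩ := decay_pos hb (μ+1) hr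
  obtain ⟨C₃, hC₃, h3⟩ := decay_pos hb (μ+1-ρ) hr
  have hσ : ∀ θ ω : ℝ, (1 + ω * Complex.I + ((θ^2 : ℝ) : ℂ) * ((1:ℝ):ℂ)) = ((1 + θ^2 : ℝ) : ℂ) + ω * Complex.I := by
    intro θ ω; push_cast; ring
  have hv : ∀ θ ω : ℝ, _ := fun θ ω => vert_reg hb.εpos (σ := 1 + θ^2) (by nlinarith [sq_nonneg θ]) ω
  have key : ∀ θ : ℝ, _ := fun θ => Fk_deform (b := b) (ρ := ρ) (μ := μ) (r := r) (t := t) (E := 0) hb.εle (h1 r le_rfl) (h2 r le_rfl) (h3 r le_rfl)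
    hC₁ hC₂ hC₃
    (fun θ => θ^2) (fun θ => 2 * θ) (fun ω => 1) (fun ω => 0)
    (fun θ => by simpa using hasDerivAt_pow 2 θ) (by fun_prop)
    (fun ω => hasDerivAt_const _ _) continuous_const (fun ω => by simp) (fun ω => by simp)
    (fun θ ω => by rw [hσ]; exact (hv θ ω).1)
    (fun θ ω => by rw [hσ, ← (hv θ ω).2]; nlinarith [sq_nonneg θ, sq_nonneg ω])
    (fun θ ω => by
      rw [hσ]
      have : ((1 + θ^2 : ℝ) + ω * Complex.I : ℂ).re = 1 + θ^2 := by
        rw [Complex.add_re, Complex.ofReal_re]; simp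
      rw [this]; nlinarith [sq_nonneg θ]) 0 θ
  have hlim : Tendsto (fun θ : ℝ => ∫ ω : ℝ, Fk b ρ μ r t (1 + ω * Complex.I + ((θ^2 : ℝ) : ℂ) * ((1:ℝ):ℂ)) *
      (Complex.I + ((θ^2 : ℝ) : ℂ) * ((0:ℝ):ℂ))) atTop (𝓝 0) := by
    have hb' : ∀ θ ω : ℝ, ‖Fk b ρ μ r t (1 + ω * Complex.I + ((θ^2 : ℝ) : ℂ) * ((1:ℝ):ℂ)) *
      (Complex.I + ((θ^2 : ℝ) : ℂ) * ((0:ℝ):ℂ))‖ ≤ (C₁ * (1 + θ^2)⁻¹) * (1 + ω^2)⁻¹ := by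
      intro θ ω
      rw [hσ]
      have hre : ((1 + θ^2 : ℝ) + ω * Complex.I : ℂ).re = 1 + θ^2 := by
        rw [Complex.add_re, Complex.ofReal_re]; simp
      have hh := h1 r le_rfl _ (hv θ ω).1
      have h4 : (‖((1 + θ^2 : ℝ) + ω * Complex.I : ℂ)‖^4)⁻¹ ≤ (1 + θ^2)⁻¹ * (1 + ω^2)⁻¹ := by
        rw [← mul_inv]
        apply inv_anti₀ (by positivity)
        have : ‖((1 + θ^2 : ℝ) + ω * Complex.I : ℂ)‖^4 = ((1+θ^2)^2 + ω^2)^2 := by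
          rw [(hv θ ω).2]; ring
        rw [this]
        have a1 : 1 + θ^2 ≤ (1+θ^2)^2 + ω^2 := by nlinarith [sq_nonneg θ, sq_nonneg ω]
        have a2 : 1 + ω^2 ≤ (1+θ^2)^2 + ω^2 := by nlinarith [sq_nonneg θ, sq_nonneg ω]
        rw [sq ((1+θ^2)^2 + ω^2)]
        gcongr
      have h5 : ‖Complex.exp (((1 + θ^2 : ℝ) + ω * Complex.I : ℂ) * t)‖ ≤ 1 := by
        rw [Complex.norm_exp, Complex.re_mul_ofReal, hre]
        apply Real.exp_le_one_iff.mpr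
        nlinarith [sq_nonneg θ]
      have e0 : (Complex.I + ((θ^2 : ℝ) : ℂ) * ((0:ℝ):ℂ)) = Complex.I := by simp
      rw [e0, norm_mul, Complex.norm_I, mul_one, Fk, norm_mul]
      calc _ ≤ 1 * (C₁ * (‖((1 + θ^2 : ℝ) + ω * Complex.I : ℂ)‖^4)⁻¹) := by gcongr
        _ ≤ 1 * (C₁ * ((1 + θ^2)⁻¹ * (1 + ω^2)⁻¹)) := by gcongr
        _ = _ := by ring
    refine squeeze_zero_norm (a := fun θ => (C₁ * (1 + θ^2)⁻¹) * ∫ ω : ℝ, (1 + ω^2)⁻¹) ?_ ?_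
    · intro θ
      rw [← integral_const_mul]
      exact norm_integral_le_of_norm_le (integrable_inv_one_add_sq.const_mul _) (ae_of_all _ (hb' θ))
    · have := (tendsto_one_add_sq_inv_top.const_mul C₁).mul_const (∫ ω : ℝ, (1 + ω^2)⁻¹)
      rwa [mul_zero, zero_mul] at this
  have hc := hlim.congr (fun θ => (key θ).symm)
  have h0 := tendsto_nhds_unique hc tendsto_const_nhds
  rw [eq_comm, integral_congr_ae (g := fun ω : ℝ => Fk b ρ μ r t (1 + ω * Complex.I) * Complex.I) (ae_of_all _ fun ω => by simp),
    integral_mul_const] at h0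
  simpa using h0

/-! ### Laplace transform of powers -/

lemma lap_integrable {ν c : ℝ} (hν : 0 < ν) (hc : 0 < c) :
    IntegrableOn (fun u : ℝ => u ^ (ν - 1) * Real.exp (-(c * u))) (Ioi 0) := by
  have := integrableOn_rpow_mul_exp_neg_mul_rpow (s := ν - 1) (p := 1) (b := c) (by linarith) one_pos hc
  simpa [neg_mul] using this

lemma lap_norm (ν : ℝ) (s : ℂ) {u : ℝ} (hu : 0 < u) :
    ‖((u ^ (ν - 1) : ℝ) : ℂ) * Complex.exp (-(s * u))‖ = u ^ (ν - 1) * Real.exp (-(s.re * u)) := by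
  rw [norm_mul, Complex.norm_real, Complex.norm_exp, Complex.neg_re, Complex.re_mul_ofReal,
    Real.norm_of_nonneg (by positivity)]

lemma lap_meas (ν : ℝ) (s : ℂ) :
    Measurable (fun u : ℝ => ((u ^ (ν - 1) : ℝ) : ℂ) * Complex.exp (-(s * u))) := by
  have h1 : Measurable (fun u : ℝ => u ^ (ν - 1)) := measurable_id.pow_const _
  have h2 : Continuous (fun u : ℝ => Complex.exp (-(s * u))) := by fun_prop
  exact (Complex.measurable_ofReal.comp h1).mul h2.measurable

lemma lap_integrable' {ν : ℝ} {s : ℂ} (hν : 0 < ν) (hs : 0 < s.re) :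
    IntegrableOn (fun u : ℝ => ((u ^ (ν - 1) : ℝ) : ℂ) * Complex.exp (-(s * u))) (Ioi 0) := by
  refine (lap_integrable hν hs).mono' (lap_meas ν s).aestronglyMeasurable ?_
  filter_upwards [ae_restrict_mem measurableSet_Ioi] with u hu
  exact (lap_norm ν s hu).le

lemma lap_complex {ν : ℝ} (hν : 0 < ν) {s : ℂ} (hs : 0 < s.re) :
    ∫ u in Ioi (0:ℝ), ((u ^ (ν - 1) : ℝ) : ℂ) * Complex.exp (-(s * u)) =
      Complex.Gamma ν * s ^ (-(ν:ℂ)) := by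
  set U : Set ℂ := {s | 0 < s.re} with hU
  have hUo : IsOpen U := isOpen_lt continuous_const Complex.continuous_re
  have hUc : IsPreconnected U := (convex_halfSpace_re_gt 0).isPreconnected
  have hf : DifferentiableOn ℂ (fun s : ℂ => ∫ u in Ioi (0:ℝ), ((u ^ (ν - 1) : ℝ) : ℂ) * Complex.exp (-(s * u))) U := by
    intro s hs
    have hs : 0 < s.re := hs
    have key := hasDerivAt_integral_of_dominated_loc_of_deriv_le (μ := volume.restrict (Ioi (0:ℝ))) (x₀ := s) (𝕜 := ℂ)
      (F := fun (s:ℂ) (u:ℝ) => ((u ^ (ν - 1) : ℝ) : ℂ) * Complex.exp (-(s * u)))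
      (F' := fun s (u:ℝ) => ((u ^ (ν - 1) : ℝ) : ℂ) * (Complex.exp (-(s * u)) * (-u)))
      (bound := fun u => u ^ (ν + 1 - 1) * Real.exp (-(s.re/2 * u)))
      (Metric.ball_mem_nhds s (half_pos hs)) ?_ ?_ ?_ ?_ ?_ ?_
    · exact key.2.differentiableAt.differentiableWithinAt
    · exact Eventually.of_forall fun s => (lap_meas ν s).aestronglyMeasurable
    · exact lap_integrable' hν hs
    · have : Measurable (fun u : ℝ => (((u ^ (ν - 1) : ℝ) : ℂ) * Complex.exp (-(s * u))) * (-(u:ℂ))) :=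
        (lap_meas ν s).mul (Complex.measurable_ofReal.neg)
      refine this.aestronglyMeasurable.congr (ae_of_all _ fun u => ?_)
      simp only; ring
    · filter_upwards [ae_restrict_mem measurableSet_Ioi] with u hu z hz
      have hu : 0 < u := hu
      have hz' : s.re / 2 ≤ z.re := by
        have h1 : ‖z - s‖ < s.re / 2 := by simpa [dist_eq_norm] using hz
        have h2 := (abs_le.mp ((Complex.abs_re_le_norm (z - s)).trans h1.le)).1
        rw [Complex.sub_re] at h2
        linarith
      rw [← mul_assoc, norm_mul, lap_norm ν z hu, norm_neg, Complex.norm_real, Real.norm_of_nonneg hu.le]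
      have e : u ^ (ν + 1 - 1) = u ^ (ν - 1) * u := by
        rw [← Real.rpow_add_one hu.ne']; congr 1; ring
      rw [e]
      have : Real.exp (-(z.re * u)) ≤ Real.exp (-(s.re / 2 * u)) := by
        apply Real.exp_le_exp.mpr
        nlinarith
      calc u ^ (ν - 1) * Real.exp (-(z.re * u)) * u ≤ u ^ (ν - 1) * Real.exp (-(s.re/2 * u)) * u := by gcongr
        _ = _ := by ring
    · exact lap_integrable (by linarith) (half_pos hs)
    · refine ae_of_all _ fun u z _ => ?_
      have h1 : HasDerivAt (fun z : ℂ => -(z * u)) (-(u:ℂ)) z := by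
        exact (((hasDerivAt_id z).mul_const (u:ℂ)).neg).congr_deriv (by simp)
      exact (h1.cexp).const_mul _
  have hg : DifferentiableOn ℂ (fun s : ℂ => Complex.Gamma ν * s ^ (-(ν:ℂ))) U := by
    intro s hs
    have hs' : s ∈ Complex.slitPlane := Or.inl hs
    exact (((hasDerivAt_id s).cpow_const hs').differentiableAt.const_mul _).differentiableWithinAt
  have h1 : (1:ℂ) ∈ U := by simp [hU]
  have := (hf.analyticOnNhd hUo).eqOn_of_preconnected_of_frequently_eq (hg.analyticOnNhd hUo) hUc h1 ?_
  · exact this hs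
  · have ht : Tendsto (fun x : ℝ => (x:ℂ)) (𝓝[≠] 1) (𝓝[≠] 1) := by
      rw [tendsto_nhdsWithin_iff]
      constructor
      · have : Tendsto (fun x : ℝ => (x:ℂ)) (𝓝 1) (𝓝 ((1:ℝ):ℂ)) := Complex.continuous_ofReal.tendsto 1
        simpa using this.mono_left nhdsWithin_le_nhds
      · filter_upwards [self_mem_nhdsWithin] with x hx
        simpa using hx
    refine ht.frequently (Eventually.frequently ?_)
    have : ∀ᶠ x : ℝ in 𝓝[≠] 1, 0 < x := nhdsWithin_le_nhds (lt_mem_nhds one_pos)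
    filter_upwards [this] with x hx
    have h2 := Complex.integral_cpow_mul_exp_neg_mul_Ioi (a := (ν:ℂ)) (r := x) (by simpa using hν) hx
    rw [mul_comm (Complex.Gamma _)]
    have e : ((1:ℂ) / x) ^ (ν:ℂ) = (x:ℂ) ^ (-(ν:ℂ)) := by
      rw [one_div, Complex.inv_cpow, Complex.cpow_neg]
      rw [Complex.arg_ofReal_of_nonneg hx.le]; exact Real.pi_pos.ne
    rw [← e, ← h2]
    refine setIntegral_congr_fun measurableSet_Ioi fun u hu => ?_
    have e2 := Complex.ofReal_cpow (le_of_lt hu) (ν - 1)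
    push_cast at e2 ⊢
    rw [e2]

lemma hankel_vert {ν t : ℝ} (hν : 2 ≤ ν) (ht : 0 < t) :
    ∫ ω : ℝ, Complex.exp ((1 + ω * Complex.I) * t) * (1 + ω * Complex.I) ^ (-(ν:ℂ)) =
      2 * π * ((t ^ (ν - 1) : ℝ) : ℂ) / Complex.Gamma ν := by
  have hν0 : 0 < ν := by linarith
  set f : ℝ → ℂ := (Ioi (0:ℝ)).indicator (fun u => ((u ^ (ν - 1) : ℝ) : ℂ) * Complex.exp (-(1 * u))) with hf
  have hfi : Integrable f := by
    rw [hf, integrable_indicator_iff measurableSet_Ioi]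
    exact lap_integrable' hν0 (by simp)
  have hF : ∀ w : ℝ, FourierTransform.fourier f w = Complex.Gamma ν * (1 + ((2 * π * w : ℝ) : ℂ) * Complex.I) ^ (-(ν:ℂ)) := by
    intro w
    rw [← lap_complex hν0 (by simp), Real.fourier_eq', ← integral_indicator measurableSet_Ioi]
    congr 1
    ext u
    by_cases hu : u ∈ Ioi (0:ℝ)
    · simp only [hf, indicator_of_mem hu, smul_eq_mul]
      rw [mul_left_comm, ← Complex.exp_add]
      congr 2
      simp
      ring
    · simp [hf, indicator_of_notMem hu]
  have hslit : ∀ ω : ℝ, (1 + ω * Complex.I : ℂ) ∈ Complex.slitPlane := fun ω => Or.inl (by simp)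
  have hcont : Continuous (fun ω : ℝ => (1 + ω * Complex.I : ℂ) ^ (-(ν:ℂ))) := by
    refine Continuous.cpow (by fun_prop) continuous_const hslit
  have hint : Integrable (fun ω : ℝ => (1 + ω * Complex.I : ℂ) ^ (-(ν:ℂ))) := by
    refine integrable_inv_one_add_sq.mono' hcont.aestronglyMeasurable (ae_of_all _ fun ω => ?_)
    rw [norm_cpow_neg_real]
    have hn : ‖(1 + ω * Complex.I : ℂ)‖^2 = 1 + ω^2 := by
      have := Complex.normSq_add_mul_I 1 ω
      rw [Complex.normSq_eq_norm_sq] at this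
      simpa using this
    have h1 : 1 ≤ ‖(1 + ω * Complex.I : ℂ)‖ := by
      nlinarith [sq_nonneg ω, norm_nonneg (1 + ω * Complex.I : ℂ)]
    rw [← hn, ← Real.rpow_natCast, ← Real.rpow_neg (norm_nonneg _)]
    apply Real.rpow_le_rpow_of_exponent_le h1
    push_cast; linarith
  have hFi : Integrable (FourierTransform.fourier f) := by
    have : FourierTransform.fourier f = fun w : ℝ => Complex.Gamma ν * (1 + ((2 * π * w : ℝ) : ℂ) * Complex.I) ^ (-(ν:ℂ)) := funext hF
    rw [this]
    exact (hint.comp_mul_left' (R := 2 * π) (by positivity)).const_mul _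
  have hfc : ContinuousAt f t := by
    have h1 : ContinuousAt (fun u : ℝ => ((u ^ (ν - 1) : ℝ) : ℂ) * Complex.exp (-(1 * u))) t := by
      have : ContinuousAt (fun u : ℝ => u ^ (ν - 1)) t := Real.continuousAt_rpow_const _ _ (Or.inl ht.ne')
      exact (Complex.continuous_ofReal.continuousAt.comp this).mul (by fun_prop)
    refine h1.congr ?_
    filter_upwards [Ioi_mem_nhds ht] with u hu
    rw [hf, indicator_of_mem hu]
  have hinv := hfi.fourierInv_fourier_eq hFi hfc
  rw [Real.fourierInv_eq'] at hinv
  have hft : f t = ((t ^ (ν - 1) : ℝ) : ℂ) * Complex.exp (-(1 * t)) := by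
    rw [hf, indicator_of_mem (show t ∈ Ioi (0:ℝ) from ht)]
  set g : ℝ → ℂ := fun ω => Complex.exp (ω * t * Complex.I) * (Complex.Gamma ν * (1 + ω * Complex.I) ^ (-(ν:ℂ))) with hg
  have h3 : ∫ w : ℝ, g (2 * π * w) = f t := by
    rw [← hinv]
    congr 1
    ext w
    rw [hF, hg, smul_eq_mul]
    simp only
    congr 2
    simp
    ring
  rw [Measure.integral_comp_mul_left g (2 * π), hft] at h3
  have hG : Complex.Gamma ν ≠ 0 := by
    rw [Complex.Gamma_ofReal]
    exact_mod_cast (Real.Gamma_pos_of_pos hν0).ne'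
  have h4 : ∫ ω : ℝ, g ω = (Complex.Gamma ν * Complex.exp (-(t:ℂ))) * ∫ ω : ℝ, Complex.exp ((1 + ω * Complex.I) * t) * (1 + ω * Complex.I) ^ (-(ν:ℂ)) := by
    rw [← integral_const_mul]
    congr 1
    ext ω
    rw [hg]
    simp only
    have : Complex.exp (ω * t * Complex.I) = Complex.exp (-(t:ℂ)) * Complex.exp ((1 + ω * Complex.I) * t) := by
      rw [← Complex.exp_add]; congr 1; ring
    rw [this]; ring
  generalize (∫ ω : ℝ, Complex.exp ((1 + ω * Complex.I) * t) * (1 + ω * Complex.I) ^ (-(ν:ℂ))) = J at h4 ⊢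
  rw [h4, abs_of_pos (by positivity)] at h3
  have hpi : (π:ℂ) ≠ 0 := by exact_mod_cast Real.pi_ne_zero
  have he := Complex.exp_ne_zero (-(t:ℂ))
  rw [one_mul, Complex.real_smul] at h3
  push_cast at h3 ⊢
  field_simp at h3 ⊢
  linear_combination h3

/-! ### The Hankel integral on the bent contour -/

lemma bent_decay {ε ρ t : ℝ} (hε0 : 0 < ε) (hε : ε ≤ 1/2) (hρ0 : 0 < ρ) (hρ : ρ ≤ 1/2) (ht : 0 < t)
    (ν : ℝ) {R : ℝ} (hR : 0 ≤ R) :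
    ∃ C, ∀ ω : ℝ, Real.exp ((bent ε ω).re * t) * ‖bent ε ω‖ ^ (-ν) * Real.exp (R * ‖bent ε ω‖ ^ ρ)
      ≤ C * (1 + ω^2)⁻¹ := by
  obtain ⟨m, hm⟩ := exists_nat_ge (2 - ν)
  set c := t * ε / 2 with hc
  have hc0 : 0 < c := by positivity
  set c0 := t * (1 + ε + ε/2) + R + R^2 / (2 * c) with hc0'
  refine ⟨4 * (Real.exp c0 * ((1/2:ℝ) ^ (2 - ν - m) * (m.factorial / (c/2)^m))), fun ω => ?_⟩
  obtain ⟨hreg, h2, h3, h4⟩ := bent_reg hε0.le le_rfl hε ω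
  obtain ⟨s1, s2, s3⟩ := sqrt_facts ω
  have hre := bent_re ε ω
  have him := bent_im ε ω
  have hu2 : ‖bent ε ω‖ ≤ |(bent ε ω).re| + |(bent ε ω).im| := Complex.norm_le_abs_re_add_abs_im _
  generalize bent ε ω = s at *
  set u := ‖s‖ with hu
  have hu1 : 1/2 ≤ u := hreg.1
  have hu0 : 0 < u := by linarith
  have hω0 := abs_nonneg ω
  have hre1 : |s.re| ≤ 1 + |ω| / 2 := by
    rw [hre, abs_le]; constructor <;> nlinarith
  have hωu : (u - 1) / 2 ≤ |ω| := by rw [him] at hu2; linarith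
  have hA : s.re * t ≤ t * (1 + ε + ε/2) - c * u := by
    rw [hre, hc]
    have : 1 + ε * (1 - √(1 + ω^2)) ≤ 1 + ε + ε/2 - ε/2*u := by nlinarith
    nlinarith
  have hB : u ^ ρ ≤ 1 + √u := by
    rcases le_total u 1 with h | h
    · have := Real.rpow_le_one hu0.le h hρ0.le
      have := Real.sqrt_nonneg u
      linarith
    · rw [Real.sqrt_eq_rpow]
      have := Real.rpow_le_rpow_of_exponent_le h hρ
      linarith
  have hC : R * √u ≤ c / 2 * u + R^2 / (2 * c) := by
    have e : u = √u ^ 2 := (Real.sq_sqrt hu0.le).symm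
    have : c / 2 * √u ^ 2 + R^2 / (2 * c) - R * √u = (c * √u - R)^2 / (2 * c) := by
      field_simp; ring
    have h5 : 0 ≤ (c * √u - R)^2 / (2 * c) := by positivity
    nlinarith
  have hexp : Real.exp (s.re * t) * Real.exp (R * u ^ ρ) ≤ Real.exp c0 * Real.exp (-(c/2 * u)) := by
    rw [← Real.exp_add, ← Real.exp_add]
    apply Real.exp_le_exp.mpr
    rw [hc0']
    nlinarith
  have h6 : Real.exp (-(c/2 * u)) ≤ m.factorial / (c/2 * u)^m := by
    rw [Real.exp_neg, inv_le_comm₀ (Real.exp_pos _) (by positivity), inv_div]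
    exact Real.pow_div_factorial_le_exp (c/2 * u) (by positivity) m
  have h7 : u ^ (-ν) * (m.factorial / (c/2 * u)^m) ≤ (1/2:ℝ) ^ (2 - ν - m) * (m.factorial / (c/2)^m) * (u^2)⁻¹ := by
    have e1 : u ^ (2 - ν - m) = u ^ 2 * u ^ (-ν) * (u ^ m)⁻¹ := by
      rw [← Real.rpow_natCast u m, ← Real.rpow_neg hu0.le,
        ← Real.rpow_natCast u 2, ← Real.rpow_add hu0, ← Real.rpow_add hu0]
      congr 1
    calc u ^ (-ν) * (m.factorial / (c/2 * u)^m) = u ^ (2 - ν - m) * (m.factorial / (c/2)^m) * (u^2)⁻¹ := by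
          rw [e1, mul_pow]; field_simp
      _ ≤ _ := by
          gcongr ?_ * _ * _
          exact rpow_neg_le_half hu1 (by linarith)
  have h8 : (u^2)⁻¹ ≤ 4 * (1 + ω^2)⁻¹ := by
    rw [← div_eq_mul_inv, ← inv_div]
    apply inv_anti₀ (by positivity)
    linarith
  calc Real.exp (s.re * t) * u ^ (-ν) * Real.exp (R * u ^ ρ)
      = (Real.exp (s.re * t) * Real.exp (R * u ^ ρ)) * u ^ (-ν) := by ring
    _ ≤ (Real.exp c0 * (m.factorial / (c/2 * u)^m)) * u ^ (-ν) := by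
        exact mul_le_mul_of_nonneg_right (hexp.trans (mul_le_mul_of_nonneg_left h6 (Real.exp_pos _).le)) (by positivity)
    _ = Real.exp c0 * (u ^ (-ν) * (m.factorial / (c/2 * u)^m)) := by ring
    _ ≤ Real.exp c0 * ((1/2:ℝ) ^ (2 - ν - m) * (m.factorial / (c/2)^m) * (4 * (1 + ω^2)⁻¹)) := by
        exact mul_le_mul_of_nonneg_left (h7.trans (mul_le_mul_of_nonneg_left h8 (by positivity))) (Real.exp_pos _).le
    _ = _ := by ring

lemma bent_hasDerivAt (ε ω : ℝ) : HasDerivAt (bent ε) (bent' ε ω) ω := by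
  have h1 := ((Complex.ofRealCLM.hasDerivAt (x := ω)).mul_const Complex.I).const_add (1:ℂ)
  have h2 := (hasDerivAt_g ω).ofReal_comp.const_mul (ε : ℂ)
  exact (h1.add h2).congr_deriv (by simp [bent'])

lemma bent_continuous (ε : ℝ) : Continuous (bent ε) :=
  continuous_iff_continuousAt.mpr fun ω => (bent_hasDerivAt ε ω).continuousAt

lemma bent'_continuous (ε : ℝ) : Continuous (bent' ε) := by
  unfold bent'
  exact continuous_const.add (continuous_const.mul (Complex.continuous_ofReal.comp continuous_g'))

lemma bent'_norm {ε : ℝ} (hε0 : 0 < ε) (hε : ε ≤ 1/2) (ω : ℝ) : ‖bent' ε ω‖ ≤ 2 := by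
  unfold bent'
  refine (norm_add_le _ _).trans ?_
  rw [Complex.norm_I, norm_mul, Complex.norm_real, Complex.norm_real, Real.norm_eq_abs, Real.norm_eq_abs,
    abs_of_pos hε0]
  have := g'_bound ω
  nlinarith

noncomputable def hInt (ε t ν ω : ℝ) : ℂ := Complex.exp (bent ε ω * t) * (bent ε ω) ^ (-(ν:ℂ))

lemma hInt_continuous {ε : ℝ} (hε0 : 0 < ε) (hε : ε ≤ 1/2) (t ν : ℝ) : Continuous (hInt ε t ν) := by
  unfold hInt
  refine Continuous.mul ?_ ?_
  · exact Complex.continuous_exp.comp ((bent_continuous ε).mul continuous_const)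
  · exact (bent_continuous ε).cpow continuous_const fun ω => (bent_reg hε0.le le_rfl hε ω).1.slit hε

lemma hInt_norm (ε t ν ω : ℝ) : ‖hInt ε t ν ω‖ = Real.exp ((bent ε ω).re * t) * ‖bent ε ω‖ ^ (-ν) := by
  rw [hInt, norm_mul, norm_cpow_neg_real, Complex.norm_exp, Complex.re_mul_ofReal]

lemma hInt_bound {ε t : ℝ} (hε0 : 0 < ε) (hε : ε ≤ 1/2) (ht : 0 < t) (ν : ℝ) :
    ∃ C, ∀ ω, ‖hInt ε t ν ω‖ ≤ C * (1 + ω^2)⁻¹ := by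
  obtain ⟨C, hC⟩ := bent_decay hε0 hε (ρ := 1/2) (by norm_num) le_rfl ht ν (R := 0) le_rfl
  refine ⟨C, fun ω => ?_⟩
  rw [hInt_norm]
  simpa using hC ω

lemma hInt_integrable {ε t : ℝ} (hε0 : 0 < ε) (hε : ε ≤ 1/2) (ht : 0 < t) (ν : ℝ) :
    Integrable (fun ω => hInt ε t ν ω * bent' ε ω) := by
  obtain ⟨C, hC⟩ := hInt_bound hε0 hε ht ν
  refine ((integrable_inv_one_add_sq.const_mul C).mul_const 2).mono'
    ((hInt_continuous hε0 hε t ν).mul (bent'_continuous ε)).aestronglyMeasurable (ae_of_all _ fun ω => ?_)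
  rw [norm_mul]
  gcongr
  · exact (norm_nonneg _).trans (hC ω)
  · exact hC ω
  · exact bent'_norm hε0 hε ω

lemma hankel_rec {ε t : ℝ} (hε0 : 0 < ε) (hε : ε ≤ 1/2) (ht : 0 < t) (ν : ℝ) :
    (t:ℂ) * ∫ ω, hInt ε t ν ω * bent' ε ω = ν * ∫ ω, hInt ε t (ν+1) ω * bent' ε ω := by
  obtain ⟨C, hC⟩ := hInt_bound hε0 hε ht ν
  have hd : ∀ ω, HasDerivAt (hInt ε t ν)
      (t * (hInt ε t ν ω * bent' ε ω) - ν * (hInt ε t (ν+1) ω * bent' ε ω)) ω := by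
    intro ω
    have hs := (bent_reg hε0.le le_rfl hε ω).1.slit hε
    have h1 : HasDerivAt (fun s : ℂ => Complex.exp (s * t)) (Complex.exp (bent ε ω * t) * t) (bent ε ω) := by
      simpa using ((hasDerivAt_id (bent ε ω)).mul_const (t:ℂ)).cexp
    have h2 : HasDerivAt (fun s : ℂ => s ^ (-(ν:ℂ))) (-ν * (bent ε ω) ^ (-(ν:ℂ) - 1)) (bent ε ω) := by
      simpa using (hasDerivAt_id (bent ε ω)).cpow_const hs (c := -(ν:ℂ))
    have h3 := (h1.mul h2).comp ω (bent_hasDerivAt ε ω)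
    refine h3.congr_deriv ?_
    have e1 : (bent ε ω) ^ (-((ν + 1 : ℝ):ℂ)) = (bent ε ω) ^ (-(ν:ℂ) - 1) := by congr 1; push_cast; ring
    simp only [hInt, e1]
    ring
  have hi1 := (hInt_integrable hε0 hε ht ν).const_mul (t:ℂ)
  have hi2 := (hInt_integrable hε0 hε ht (ν+1)).const_mul (ν:ℂ)
  have := integral_of_hasDerivAt_of_tendsto (m := 0) (n := 0) hd (hi1.sub hi2)
      (squeeze_zero_norm hC (by simpa using tendsto_one_add_sq_inv_bot.const_mul C))
      (squeeze_zero_norm hC (by simpa using tendsto_one_add_sq_inv_top.const_mul C))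
  rw [integral_sub hi1 hi2, integral_const_mul, integral_const_mul] at this
  simpa [sub_eq_zero] using this

lemma hankel_bent {ε t : ℝ} (hε0 : 0 < ε) (hε : ε ≤ 1/2) (ht : 0 < t) (ν : ℝ) :
    ∫ ω, hInt ε t ν ω * bent' ε ω = 2 * π * Complex.I * (((t ^ (ν - 1) : ℝ) : ℂ) / Complex.Gamma ν) := by
  have base : ∀ ν : ℝ, 5 ≤ ν → ∫ ω, hInt ε t ν ω * bent' ε ω = 2 * π * Complex.I * (((t ^ (ν - 1) : ℝ) : ℂ) / Complex.Gamma ν) := by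
    intro ν hν
    have h := Fk_bend (b := 1) (ρ := 1) (t := t) hε0 hε (decay_zero 1 1 ε (μ := ν) (by linarith))
      (decay_zero 1 1 ε (μ := ν+1) (by linarith)) (decay_zero 1 1 ε (μ := ν+1-1) (by linarith))
      (by positivity) (by positivity) (by positivity) ht.le
    have e : ∀ s, Fk 1 1 ν 0 t s = Complex.exp (s * t) * s ^ (-(ν:ℂ)) := by
      intro s; simp [Fk]
    simp only [e] at h
    rw [integral_mul_const, hankel_vert (by linarith) ht] at h
    simp only [hInt]
    rw [← h]; ring
  have ind : ∀ n : ℕ, ∀ ν : ℝ, 5 ≤ ν + n → ∫ ω, hInt ε t ν ω * bent' ε ω = 2 * π * Complex.I * (((t ^ (ν - 1) : ℝ) : ℂ) / Complex.Gamma ν) := by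
    intro n
    induction n with
    | zero => intro ν hν; exact base ν (by simpa using hν)
    | succ n ih =>
      intro ν hν
      have h1 := ih (ν + 1) (by push_cast at hν; linarith)
      have h2 := hankel_rec hε0 hε ht ν
      rw [h1] at h2
      have ht' : (t:ℂ) ≠ 0 := by exact_mod_cast ht.ne'
      apply mul_left_cancel₀ ht'
      rw [h2]
      have e1 : ((t ^ (ν + 1 - 1) : ℝ) : ℂ) = t * ((t ^ (ν - 1) : ℝ) : ℂ) := by
        rw [← Complex.ofReal_mul, mul_comm, ← Real.rpow_add_one ht.ne']; congr 2; ring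
      rw [e1, div_eq_mul_inv, div_eq_mul_inv,
        Complex.one_div_Gamma_eq_self_mul_one_div_Gamma_add_one (ν:ℂ)]
      push_cast
      ring
  obtain ⟨n, hn⟩ := exists_nat_ge (5 - ν)
  exact ind n ν (by linarith)

/-! ### The kernel -/

noncomputable def Kv (b : ℂ) (ρ μ r t : ℝ) : ℂ :=
  (1 / (2 * π) : ℂ) * ∫ ω : ℝ, Fk b ρ μ r t (1 + ω * Complex.I)

lemma Kv_eq_wright {b : ℂ} {ρ ε κ μ r t : ℝ} (hb : GoodB b ρ ε κ) (hr : 0 < r) (ht : 0 < t) :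
    Kv b ρ μ r t = ((t ^ (μ - 1) : ℝ) : ℂ) * wrightPhi (-(ρ:ℂ)) μ (-b * ((r / t ^ ρ : ℝ) : ℂ)) := by
  obtain ⟨C₁, hC₁, h1⟩ := decay_pos hb μ hr
  obtain ⟨C₂, hC₂, h2⟩ := decay_pos hb (μ+1) hr
  obtain ⟨C₃, hC₃, h3⟩ := decay_pos hb (μ+1-ρ) hr
  have hbend := Fk_bend (t := t) hb.εpos hb.εle (h1 r le_rfl) (h2 r le_rfl) (h3 r le_rfl)
    hC₁ hC₂ hC₃ ht.le
  rw [integral_mul_const] at hbend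
  have hε0 := hb.εpos
  have hε := hb.εle
  set R := ‖b‖ * r with hRdef
  have hR : 0 ≤ R := by positivity
  obtain ⟨C, hC⟩ := bent_decay hε0 hε hb.ρpos hb.ρlt.le ht μ hR
  have hcont : Continuous (fun ω => Real.exp ((bent ε ω).re * t) * ‖bent ε ω‖ ^ (-μ) * Real.exp (R * ‖bent ε ω‖ ^ ρ) * 2) := by
    have hc := bent_continuous ε
    have hne : ∀ ω, ‖bent ε ω‖ ≠ 0 := fun ω => norm_ne_zero_iff.mpr (bent_reg hε0.le le_rfl hε ω).1.ne_zero
    have c1 : Continuous (fun ω => ‖bent ε ω‖ ^ (-μ)) := hc.norm.rpow_const fun ω => Or.inl (hne ω)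
    have c2 : Continuous (fun ω => ‖bent ε ω‖ ^ ρ) := hc.norm.rpow_const fun ω => Or.inl (hne ω)
    have c3 : Continuous (fun ω => (bent ε ω).re) := Complex.continuous_re.comp hc
    fun_prop
  have hsumexp : ∀ ω, HasSum (fun n : ℕ => Real.exp ((bent ε ω).re * t) * ‖bent ε ω‖ ^ (-μ) * ((R * ‖bent ε ω‖ ^ ρ)^n / n.factorial) * 2)
      (Real.exp ((bent ε ω).re * t) * ‖bent ε ω‖ ^ (-μ) * Real.exp (R * ‖bent ε ω‖ ^ ρ) * 2) := by
    intro ω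
    have := NormedSpace.expSeries_div_hasSum_exp (R * ‖bent ε ω‖ ^ ρ)
    rw [← Real.exp_eq_exp_ℝ] at this
    exact (this.mul_left _).mul_right _
  have key := hasSum_integral_of_dominated_convergence (μ := volume)
    (F := fun (n:ℕ) ω => (-(b * r))^n / n.factorial * (hInt ε t (μ - ρ * n) ω * bent' ε ω))
    (f := fun ω => Fk b ρ μ r t (bent ε ω) * bent' ε ω)
    (fun (n:ℕ) ω => Real.exp ((bent ε ω).re * t) * ‖bent ε ω‖ ^ (-μ) * ((R * ‖bent ε ω‖ ^ ρ)^n / n.factorial) * 2)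
    ?_ ?_ ?_ ?_ ?_
  · simp only [integral_const_mul, hankel_bent hε0 hε ht] at key
    rw [← hbend] at key
    have hpi : (π:ℂ) ≠ 0 := by exact_mod_cast Real.pi_ne_zero
    have hI := Complex.I_ne_zero
    have key2 := (key.mul_left (1 / (2 * π * Complex.I) : ℂ)).tsum_eq
    have e : Kv b ρ μ r t = (1 / (2 * π * Complex.I) : ℂ) * ((∫ ω : ℝ, Fk b ρ μ r t (1 + ω * Complex.I)) * Complex.I) := by
      rw [Kv]; generalize (∫ ω : ℝ, Fk b ρ μ r t (1 + ω * Complex.I)) = J; field_simp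
    rw [e, ← key2, wrightPhi, ← tsum_mul_left]
    congr 1
    ext n
    have e1 : ((t ^ (μ - ρ * n - 1) : ℝ) : ℂ) = ((t ^ (μ - 1) : ℝ) : ℂ) / ((t ^ ρ : ℝ) : ℂ) ^ n := by
      rw [← Complex.ofReal_pow, ← Complex.ofReal_div]
      congr 1
      rw [← Real.rpow_natCast, ← Real.rpow_mul ht.le, ← Real.rpow_sub ht]
      congr 1; ring
    have e2 : ((μ - ρ * n : ℝ) : ℂ) = -(ρ:ℂ) * n + μ := by push_cast; ring
    rw [e1, e2, Complex.ofReal_div]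
    have e3 : (-b * ((r:ℂ) / ((t ^ ρ : ℝ) : ℂ)))^n = (-(b * r))^n / ((t ^ ρ : ℝ) : ℂ) ^ n := by
      rw [← div_pow]; congr 1; ring
    rw [e3]
    field_simp
  · intro n
    exact (continuous_const.mul ((hInt_continuous hε0 hε t _).mul (bent'_continuous ε))).aestronglyMeasurable
  · intro n
    refine ae_of_all _ fun ω => ?_
    have hn : 0 < ‖bent ε ω‖ := norm_pos_iff.mpr (bent_reg hε0.le le_rfl hε ω).1.ne_zero
    rw [norm_mul, norm_mul, hInt_norm, norm_div, norm_pow, norm_neg, norm_mul, Complex.norm_real,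
      Real.norm_of_nonneg hr.le, Complex.norm_natCast]
    have e1 : ‖bent ε ω‖ ^ (-(μ - ρ * n)) = ‖bent ε ω‖ ^ (-μ) * (‖bent ε ω‖ ^ ρ) ^ n := by
      rw [← Real.rpow_natCast, ← Real.rpow_mul hn.le, ← Real.rpow_add hn]
      congr 1; ring
    rw [e1, ← hRdef, mul_pow R]
    calc _ ≤ R ^ n / n.factorial * (Real.exp ((bent ε ω).re * t) * (‖bent ε ω‖ ^ (-μ) * (‖bent ε ω‖ ^ ρ) ^ n) * 2) := by
          gcongr
          exact bent'_norm hε0 hε ω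
      _ = _ := by ring
  · exact ae_of_all _ fun ω => (hsumexp ω).summable
  · have : (fun ω => ∑' n : ℕ, Real.exp ((bent ε ω).re * t) * ‖bent ε ω‖ ^ (-μ) * ((R * ‖bent ε ω‖ ^ ρ)^n / n.factorial) * 2)
        = fun ω => (Real.exp ((bent ε ω).re * t) * ‖bent ε ω‖ ^ (-μ) * Real.exp (R * ‖bent ε ω‖ ^ ρ) * 2) :=
      funext fun ω => (hsumexp ω).tsum_eq
    rw [this]
    refine ((integrable_inv_one_add_sq.const_mul C).mul_const 2).mono' hcont.aestronglyMeasurable (ae_of_all _ fun ω => ?_)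
    rw [Real.norm_of_nonneg (by positivity)]
    exact mul_le_mul_of_nonneg_right (hC ω) (by norm_num)
  · refine ae_of_all _ fun ω => ?_
    have hne := (bent_reg hε0.le le_rfl hε ω).1.ne_zero
    have h := NormedSpace.expSeries_div_hasSum_exp (-(b * r * bent ε ω ^ (ρ:ℂ)))
    rw [← Complex.exp_eq_exp_ℂ] at h
    have h' := (h.mul_left (Complex.exp (bent ε ω * t) * bent ε ω ^ (-(μ:ℂ)))).mul_right (bent' ε ω)
    have e : Complex.exp (bent ε ω * t) * bent ε ω ^ (-(μ:ℂ)) * Complex.exp (-(b * r * bent ε ω ^ (ρ:ℂ))) * bent' ε ω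
      = Fk b ρ μ r t (bent ε ω) * bent' ε ω := by rw [Fk]; ring
    rw [e] at h'
    refine h'.congr_fun ?_
    intro n
    have e1 : bent ε ω ^ (-((μ - ρ * n : ℝ) : ℂ)) = bent ε ω ^ (-(μ:ℂ)) * (bent ε ω ^ (ρ:ℂ)) ^ n := by
      rw [← Complex.cpow_mul_nat, ← Complex.cpow_add _ _ hne]
      congr 1; push_cast; ring
    rw [hInt, e1]
    have e2 : (-(b * r * bent ε ω ^ (ρ:ℂ)))^n = (-(b * r))^n * (bent ε ω ^ (ρ:ℂ)) ^ n := by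
      rw [← mul_pow]; congr 1; ring
    rw [e2]
    ring


/-! ### Properties of the kernel -/

lemma vone_re (ω : ℝ) : (1 + ω * Complex.I : ℂ).re = 1 := by simp

lemma vone_slit (ω : ℝ) : (1 + ω * Complex.I : ℂ) ∈ Complex.slitPlane := by
  left; rw [vone_re]; exact one_pos

lemma vone_ne (ω : ℝ) : (1 + ω * Complex.I : ℂ) ≠ 0 := Complex.slitPlane_ne_zero (vone_slit ω)

lemma Fk_vert_bound {b : ℂ} {ρ ε κ : ℝ} (hb : GoodB b ρ ε κ) (μ : ℝ) {r0 : ℝ} (hr0 : 0 < r0) :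
    ∃ C, 0 ≤ C ∧ ∀ r, r0 ≤ r → ∀ t ω : ℝ,
      ‖Fk b ρ μ r t (1 + ω * Complex.I)‖ ≤ Real.exp t * C * (1 + ω^2)⁻¹ := by
  obtain ⟨C, hC, h⟩ := decay_pos hb μ hr0
  refine ⟨16 * C, by positivity, fun r hr t ω => ?_⟩
  obtain ⟨hv1, hv2⟩ := vert_reg hb.εpos (σ := 1) le_rfl ω
  rw [Complex.ofReal_one] at hv1 hv2
  have := Fk_bound (t := t) (E := t) (ω := ω) (h r hr) hv1 hC (by rw [← hv2]; nlinarith [sq_nonneg ω])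
    (by rw [vone_re]; linarith)
  refine this.trans (mul_le_mul_of_nonneg_left ?_ (by positivity))
  apply inv_anti₀ (by positivity)
  nlinarith [sq_nonneg ω]

lemma Fk_vert_cont (b : ℂ) (ρ μ r t : ℝ) : Continuous (fun ω : ℝ => Fk b ρ μ r t (1 + ω * Complex.I)) := by
  have h : Continuous (fun ω : ℝ => (1 + ω * Complex.I : ℂ)) := by fun_prop
  refine continuous_iff_continuousAt.mpr fun ω => ?_
  exact ContinuousAt.comp (f := fun ω : ℝ => (1 + ω * Complex.I : ℂ))
    (Fk_hasDerivAt b ρ μ r t (vone_slit ω)).continuousAt h.continuousAt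

lemma Fk_vert_integrable {b : ℂ} {ρ ε κ : ℝ} (hb : GoodB b ρ ε κ) (μ : ℝ) {r : ℝ} (hr : 0 < r) (t : ℝ) :
    Integrable (fun ω : ℝ => Fk b ρ μ r t (1 + ω * Complex.I)) := by
  obtain ⟨C, hC, h⟩ := Fk_vert_bound hb μ hr
  exact (integrable_inv_one_add_sq.const_mul (Real.exp t * C)).mono'
    (Fk_vert_cont b ρ μ r t).aestronglyMeasurable (ae_of_all _ fun ω => h r le_rfl t ω)

lemma Kv_bound {b : ℂ} {ρ ε κ : ℝ} (hb : GoodB b ρ ε κ) (μ : ℝ) {r0 : ℝ} (hr0 : 0 < r0) :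
    ∃ C, 0 ≤ C ∧ ∀ r, r0 ≤ r → ∀ t : ℝ, ‖Kv b ρ μ r t‖ ≤ C * Real.exp t := by
  obtain ⟨C, hC, h⟩ := Fk_vert_bound hb μ hr0
  refine ⟨‖(1 / (2 * π) : ℂ)‖ * (C * π), by positivity, fun r hr t => ?_⟩
  rw [Kv, norm_mul, mul_assoc]
  refine mul_le_mul_of_nonneg_left ?_ (norm_nonneg _)
  refine (norm_integral_le_of_norm_le (integrable_inv_one_add_sq.const_mul (Real.exp t * C))
    (ae_of_all _ fun ω => h r hr t ω)).trans (le_of_eq ?_)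
  rw [integral_const_mul, integral_univ_inv_one_add_sq]; ring

lemma Kv_zero {b : ℂ} {ρ ε κ μ r t : ℝ} (hb : GoodB b ρ ε κ) (hr : 0 < r) (ht : t ≤ 0) :
    Kv b ρ μ r t = 0 := by
  rw [Kv, Fk_shift hb hr ht, mul_zero]

lemma Kv_hasDerivAt_t {b : ℂ} {ρ ε κ : ℝ} (hb : GoodB b ρ ε κ) (μ : ℝ) {r : ℝ} (hr : 0 < r) (t : ℝ) :
    HasDerivAt (fun t => Kv b ρ μ r t) (Kv b ρ (μ - 1) r t) t := by
  obtain ⟨C, hC, h⟩ := Fk_vert_bound hb (μ - 1) hr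
  have := hasDerivAt_integral_of_dominated_loc_of_deriv_le (μ := volume) (𝕜 := ℝ)
    (F := fun (t:ℝ) (ω:ℝ) => Fk b ρ μ r t (1 + ω * Complex.I))
    (F' := fun (t:ℝ) (ω:ℝ) => Fk b ρ (μ - 1) r t (1 + ω * Complex.I)) (x₀ := t) (s := Iio (t + 1))
    (bound := fun ω => Real.exp (t + 1) * C * (1 + ω^2)⁻¹)
    (Iio_mem_nhds (by linarith))
    (Eventually.of_forall fun t => (Fk_vert_cont b ρ μ r t).aestronglyMeasurable)
    (Fk_vert_integrable hb μ hr t) (Fk_vert_cont b ρ (μ - 1) r t).aestronglyMeasurable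
    (ae_of_all _ fun ω x hx => ?_) (integrable_inv_one_add_sq.const_mul _)
    (ae_of_all _ fun ω x hx => ?_)
  · exact this.2.const_mul _
  · refine (h r le_rfl x ω).trans ?_
    have : Real.exp x ≤ Real.exp (t+1) := Real.exp_le_exp.mpr (le_of_lt hx)
    gcongr
  · have hne := vone_ne ω
    generalize (1 + ω * Complex.I : ℂ) = s at *
    have h1 : HasDerivAt (fun x : ℝ => Complex.exp (s * x)) (Complex.exp (s * x) * s) x := by
      have h0 := (Complex.ofRealCLM.hasDerivAt (x := x)).const_mul s
      simpa using h0.cexp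
    unfold Fk
    refine (h1.mul_const _).congr_deriv ?_
    have : s ^ (-((μ - 1 : ℝ) : ℂ)) = s * s ^ (-(μ:ℂ)) := by
      have e := Complex.cpow_add 1 (-(μ:ℂ)) hne
      rw [Complex.cpow_one] at e
      rw [← e]; congr 1; push_cast; ring
    rw [this]; ring

lemma Kv_hasDerivAt_r {b : ℂ} {ρ ε κ : ℝ} (hb : GoodB b ρ ε κ) (μ : ℝ) {r : ℝ} (hr : 0 < r) (t : ℝ) :
    HasDerivAt (fun r => Kv b ρ μ r t) (-b * Kv b ρ (μ - ρ) r t) r := by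
  obtain ⟨C, hC, h⟩ := Fk_vert_bound hb (μ - ρ) (half_pos hr)
  have := hasDerivAt_integral_of_dominated_loc_of_deriv_le (μ := volume) (𝕜 := ℝ)
    (F := fun (r:ℝ) (ω:ℝ) => Fk b ρ μ r t (1 + ω * Complex.I))
    (F' := fun (r:ℝ) (ω:ℝ) => -b * Fk b ρ (μ - ρ) r t (1 + ω * Complex.I)) (x₀ := r) (s := Ioi (r / 2))
    (bound := fun ω => ‖b‖ * (Real.exp t * C * (1 + ω^2)⁻¹))
    (Ioi_mem_nhds (by linarith))
    (Eventually.of_forall fun r => (Fk_vert_cont b ρ μ r t).aestronglyMeasurable)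
    (Fk_vert_integrable hb μ hr t) (continuous_const.mul (Fk_vert_cont b ρ (μ - ρ) r t)).aestronglyMeasurable
    (ae_of_all _ fun ω x hx => ?_) ((integrable_inv_one_add_sq.const_mul _).const_mul _)
    (ae_of_all _ fun ω x hx => ?_)
  · refine (this.2.const_mul _).congr_deriv ?_
    rw [integral_const_mul, Kv]; ring
  · rw [norm_mul, norm_neg]
    exact mul_le_mul_of_nonneg_left (h x (le_of_lt hx) t ω) (norm_nonneg _)
  · have hne := vone_ne ω
    generalize (1 + ω * Complex.I : ℂ) = s at *
    have h1 : HasDerivAt (fun x : ℝ => Complex.exp (-(b * x * s ^ (ρ:ℂ))))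
        (Complex.exp (-(b * x * s ^ (ρ:ℂ))) * (-(b * s ^ (ρ:ℂ)))) x := by
      have h0 := (((Complex.ofRealCLM.hasDerivAt (x := x)).const_mul b).mul_const (s ^ (ρ:ℂ))).neg
      simpa using h0.cexp
    unfold Fk
    refine ((h1.const_mul _).const_mul _).congr_deriv ?_
    have : s ^ (-((μ - ρ : ℝ) : ℂ)) = s ^ (-(μ:ℂ)) * s ^ (ρ:ℂ) := by
      rw [← Complex.cpow_add _ _ hne]; congr 1; push_cast; ring
    rw [this]; ring

lemma Kv_cont {b : ℂ} {ρ ε κ : ℝ} (hb : GoodB b ρ ε κ) (μ : ℝ) {r : ℝ} (hr : 0 < r) :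
    Continuous (fun t => Kv b ρ μ r t) :=
  continuous_iff_continuousAt.mpr fun t => (Kv_hasDerivAt_t hb μ hr t).continuousAt

lemma Kv_frac {b : ℂ} {ρ ε κ : ℝ} (hb : GoodB b ρ ε κ) (μ : ℝ) {r : ℝ} (hr : 0 < r) {β : ℝ} (hβ : 0 < β) (v : ℝ) :
    ∫ u in Ioi (0:ℝ), ((u ^ (β - 1) : ℝ) : ℂ) * Kv b ρ μ r (v - u) = Complex.Gamma β * Kv b ρ (μ + β) r v := by
  obtain ⟨C, hC, h⟩ := Fk_vert_bound hb μ hr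
  have hF : ∀ u ω : ℝ, Fk b ρ μ r (v - u) (1 + ω * Complex.I)
      = Complex.exp (-((1 + ω * Complex.I) * u)) * Fk b ρ μ r v (1 + ω * Complex.I) := by
    intro u ω
    simp only [Fk]
    rw [← mul_assoc (Complex.exp _) (Complex.exp _), ← Complex.exp_add]
    congr 2; push_cast; ring
  have hint : Integrable (Function.uncurry fun (u ω : ℝ) => ((u ^ (β - 1) : ℝ) : ℂ) *
      (Complex.exp (-((1 + ω * Complex.I) * u)) * Fk b ρ μ r v (1 + ω * Complex.I)))
      ((volume.restrict (Ioi 0)).prod volume) := by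
    refine Integrable.mono' ((lap_integrable hβ one_pos).mul_prod
      (integrable_inv_one_add_sq.const_mul (Real.exp v * C))) ?_ ?_
    · have m1 : Measurable (fun p : ℝ × ℝ => ((p.1 ^ (β - 1) : ℝ) : ℂ)) :=
        Complex.measurable_ofReal.comp (measurable_fst.pow_const _)
      have m2 : Continuous (fun p : ℝ × ℝ => Complex.exp (-((1 + p.2 * Complex.I) * p.1))) := by fun_prop
      have m3 : Continuous (fun p : ℝ × ℝ => Fk b ρ μ r v (1 + p.2 * Complex.I)) :=
        (Fk_vert_cont b ρ μ r v).comp continuous_snd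
      exact (m1.mul (m2.mul m3).measurable).aestronglyMeasurable
    · have : ∀ᵐ p : ℝ × ℝ ∂((volume.restrict (Ioi 0)).prod volume), p.1 ∈ Ioi (0:ℝ) :=
        Measure.quasiMeasurePreserving_fst.ae (ae_restrict_mem measurableSet_Ioi)
      filter_upwards [this] with p hp
      have e := lap_norm β (1 + p.2 * Complex.I) hp
      rw [vone_re] at e
      simp only [Function.uncurry]
      rw [← mul_assoc, norm_mul, e]
      exact mul_le_mul_of_nonneg_left (h r le_rfl v p.2) (mul_nonneg (Real.rpow_nonneg (le_of_lt hp) _) (Real.exp_pos _).le)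
  calc ∫ u in Ioi (0:ℝ), ((u ^ (β - 1) : ℝ) : ℂ) * Kv b ρ μ r (v - u)
      = (1 / (2 * π) : ℂ) * ∫ u in Ioi (0:ℝ), ∫ ω : ℝ, ((u ^ (β - 1) : ℝ) : ℂ) *
      (Complex.exp (-((1 + ω * Complex.I) * u)) * Fk b ρ μ r v (1 + ω * Complex.I)) := by
        rw [← integral_const_mul]
        congr 1; ext u
        rw [Kv, integral_const_mul]
        simp only [hF]
        ring
    _ = (1 / (2 * π) : ℂ) * ∫ ω : ℝ, ∫ u in Ioi (0:ℝ), ((u ^ (β - 1) : ℝ) : ℂ) *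
      (Complex.exp (-((1 + ω * Complex.I) * u)) * Fk b ρ μ r v (1 + ω * Complex.I)) := by
        rw [integral_integral_swap hint]
    _ = (1 / (2 * π) : ℂ) * ∫ ω : ℝ, Complex.Gamma β * Fk b ρ (μ + β) r v (1 + ω * Complex.I) := by
        congr 2; ext ω
        simp only [← mul_assoc]
        rw [integral_mul_const, lap_complex hβ (by rw [vone_re]; exact one_pos)]
        have hne := vone_ne ω
        generalize (1 + ω * Complex.I : ℂ) = s at *
        have : s ^ (-((μ + β : ℝ) : ℂ)) = s ^ (-(μ:ℂ)) * s ^ (-(β:ℂ)) := by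
          rw [← Complex.cpow_add _ _ hne]; congr 1; push_cast; ring
        simp only [Fk, this]; ring
    _ = _ := by rw [integral_const_mul, Kv]; ring


/-! ### Convolution with a kernel, time variable -/

lemma ii_tau {τ : ℝ → ℝ} (hτ : Measurable τ) {M : ℝ} (hM : ∀ t, |τ t| ≤ M) (p q : ℝ) :
    IntervalIntegrable τ volume p q := by
  refine (intervalIntegrable_const (c := M)).mono_fun hτ.aestronglyMeasurable (ae_of_all _ fun x => ?_)
  exact (hM x).trans (le_abs_self M)

lemma ii_conv {k τ : ℝ → ℝ} (hk : Continuous k) (hτ : Measurable τ) {M : ℝ} (hM : ∀ t, |τ t| ≤ M) (s p q : ℝ) :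
    IntervalIntegrable (fun η => k (s - η) * τ η) volume p q :=
  (ii_tau hτ hM p q).continuousOn_mul (by fun_prop)

lemma conv_trunc {k τ : ℝ → ℝ} (hk : Continuous k) (hk0 : ∀ t ≤ 0, k t = 0) (hτ : Measurable τ) {M : ℝ}
    (hM : ∀ t, |τ t| ≤ M) {s T : ℝ} (hsT : s ≤ T) :
    ∫ η in (0:ℝ)..T, k (s - η) * τ η = ∫ η in (0:ℝ)..s, k (s - η) * τ η := by
  rw [← intervalIntegral.integral_add_adjacent_intervals (ii_conv hk hτ hM s 0 s) (ii_conv hk hτ hM s s T)]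
  have : ∫ η in s..T, k (s - η) * τ η = ∫ η in s..T, (0:ℝ) := by
    apply intervalIntegral.integral_congr
    intro η hη
    rw [uIcc_of_le hsT] at hη
    simp only [hk0 (s - η) (by linarith [hη.1]), zero_mul]
  rw [this]; simp

lemma compact_bd {k : ℝ → ℝ} (hk : Continuous k) (T : ℝ) : ∃ B, 0 ≤ B ∧ ∀ s ∈ Icc (-T) T, |k s| ≤ B := by
  obtain ⟨B, hB⟩ := (isCompact_Icc (a := -T) (b := T)).exists_bound_of_continuousOn hk.continuousOn
  exact ⟨max B 0, le_max_right _ _, fun s hs => (hB s hs).trans (le_max_left _ _)⟩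

lemma conv_hasDerivAt {k k' τ : ℝ → ℝ} (hk : Continuous k) (hk' : Continuous k')
    (hk0 : ∀ t ≤ 0, k t = 0) (hk0' : ∀ t ≤ 0, k' t = 0) (hd : ∀ t, HasDerivAt k (k' t) t)
    (hτ : Measurable τ) {M : ℝ} (hM : ∀ t, |τ t| ≤ M) {t : ℝ} (ht : 0 < t) :
    HasDerivAt (fun s => ∫ η in (0:ℝ)..s, k (s - η) * τ η) (∫ η in (0:ℝ)..t, k' (t - η) * τ η) t := by
  obtain ⟨B, hB0, hB⟩ := compact_bd hk' (t+1)
  have hnh : Ioo 0 (t+1) ∈ 𝓝 t := Ioo_mem_nhds ht (by linarith)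
  have := intervalIntegral.hasDerivAt_integral_of_dominated_loc_of_deriv_le (μ := volume) (𝕜 := ℝ)
    (F := fun s η => k (s - η) * τ η) (F' := fun s η => k' (s - η) * τ η) (x₀ := t) (a := 0) (b := t+1)
    (s := Ioo 0 (t+1)) (bound := fun _ => B * M) hnh
    (Eventually.of_forall fun s => (((hk.comp (by fun_prop : Continuous fun η => s - η)).measurable).mul hτ).aestronglyMeasurable)
    (ii_conv hk hτ hM t 0 (t+1))
    (((hk'.comp (by fun_prop : Continuous fun η => t - η)).measurable).mul hτ).aestronglyMeasurable
    (ae_of_all _ fun η hη s hs => ?_) intervalIntegrable_const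
    (ae_of_all _ fun η hη s hs => ?_)
  · have h2 := this.2
    rw [conv_trunc hk' hk0' hτ hM (by linarith : t ≤ t+1)] at h2
    refine h2.congr_of_eventuallyEq ?_
    filter_upwards [hnh] with s hs
    exact (conv_trunc hk hk0 hτ hM hs.2.le).symm
  · rw [uIoc_of_le (by linarith)] at hη
    rw [norm_mul]
    exact mul_le_mul (hB _ ⟨by linarith [hη.2, hs.1], by linarith [hη.1, hs.2]⟩) (hM η) (norm_nonneg _) hB0
  · have h1 : HasDerivAt (fun s => k (s - η)) (k' (s - η)) s := by
      simpa using (hd (s - η)).comp_sub_const s η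
    exact h1.mul_const _

lemma conv_caputo {α : ℝ} (hα0 : 0 < α) (hα1 : α < 1) {k k' kα τ w : ℝ → ℝ} (hk : Continuous k) (hk' : Continuous k')
    (hk0 : ∀ t ≤ 0, k t = 0) (hk0' : ∀ t ≤ 0, k' t = 0) (hd : ∀ t, HasDerivAt k (k' t) t)
    (hα : ∀ v, ∫ u in Ioi (0:ℝ), u ^ (-α) * k' (v - u) = Real.Gamma (1 - α) * kα v)
    (hτ : Measurable τ) {M : ℝ} (hM : ∀ t, |τ t| ≤ M)
    (hw : ∀ t, 0 < t → w t = ∫ η in (0:ℝ)..t, k (t - η) * τ η) {t : ℝ} (ht : 0 < t) :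
    caputoD α w t = ∫ η in (0:ℝ)..t, kα (t - η) * τ η := by
  have hM0 : 0 ≤ M := (abs_nonneg _).trans (hM 0)
  have hwd : ∀ ξ, 0 < ξ → deriv w ξ = ∫ η in (0:ℝ)..ξ, k' (ξ - η) * τ η := by
    intro ξ hξ
    have := conv_hasDerivAt hk hk' hk0 hk0' hd hτ hM hξ
    refine (this.congr_of_eventuallyEq ?_).deriv
    filter_upwards [Ioi_mem_nhds hξ] with s hs
    exact hw s hs
  have hΓ : Real.Gamma (1 - α) ≠ 0 := (Real.Gamma_pos_of_pos (by linarith)).ne'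
  obtain ⟨B, hB0, hB⟩ := compact_bd hk' t
  have hsing : IntegrableOn (fun ξ => (t - ξ) ^ (-α)) (Ioc 0 t) := by
    have h1 := (intervalIntegral.intervalIntegrable_rpow' (a := 0) (b := t) (r := -α) (by linarith)).comp_sub_left t
    rw [sub_zero, sub_self] at h1
    exact (intervalIntegrable_iff_integrableOn_Ioc_of_le ht.le).mp h1.symm
  have hint : Integrable (Function.uncurry fun ξ η : ℝ => ((t - ξ) ^ (-α) * k' (ξ - η)) * τ η)
      ((volume.restrict (Ioc 0 t)).prod (volume.restrict (Ioc 0 t))) := by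
    refine Integrable.mono' (hsing.mul_prod (integrable_const (B * M))) ?_ ?_
    · have m1 : Measurable (fun p : ℝ × ℝ => (t - p.1) ^ (-α)) := (measurable_const.sub measurable_fst).pow_const _
      have m2 : Measurable (fun p : ℝ × ℝ => k' (p.1 - p.2)) :=
        (hk'.comp (by fun_prop : Continuous fun p : ℝ × ℝ => p.1 - p.2)).measurable
      exact ((m1.mul m2).mul (hτ.comp measurable_snd)).aestronglyMeasurable
    · have a1 : ∀ᵐ p : ℝ × ℝ ∂((volume.restrict (Ioc 0 t)).prod (volume.restrict (Ioc 0 t))), p.1 ∈ Ioc (0:ℝ) t :=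
        Measure.quasiMeasurePreserving_fst.ae (ae_restrict_mem measurableSet_Ioc)
      have a2 : ∀ᵐ p : ℝ × ℝ ∂((volume.restrict (Ioc 0 t)).prod (volume.restrict (Ioc 0 t))), p.2 ∈ Ioc (0:ℝ) t :=
        Measure.quasiMeasurePreserving_snd.ae (ae_restrict_mem measurableSet_Ioc)
      filter_upwards [a1, a2] with p h1 h2
      simp only [Function.uncurry]
      have hp : 0 ≤ (t - p.1) ^ (-α) := Real.rpow_nonneg (by linarith [h1.2]) _
      rw [norm_mul, norm_mul, Real.norm_of_nonneg hp, mul_assoc]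
      refine mul_le_mul_of_nonneg_left ?_ hp
      exact mul_le_mul (hB _ ⟨by linarith [h1.1, h2.2], by linarith [h1.2, h2.1]⟩) (hM _) (norm_nonneg _) hB0
  have inner : ∀ η ∈ Ioc 0 t, ∫ ξ in Ioc 0 t, (t - ξ) ^ (-α) * k' (ξ - η) = Real.Gamma (1 - α) * kα (t - η) := by
    intro η hη
    rw [← hα (t - η), ← intervalIntegral.integral_of_le ht.le]
    have := intervalIntegral.integral_comp_sub_left (a := 0) (b := t) (fun u => u ^ (-α) * k' (t - η - u)) t
    rw [sub_zero, sub_self] at this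
    have e : ∀ ξ : ℝ, t - η - (t - ξ) = ξ - η := fun ξ => by ring
    simp only [e] at this
    rw [this, intervalIntegral.integral_of_le ht.le]
    symm
    apply setIntegral_eq_of_subset_of_forall_sdiff_eq_zero measurableSet_Ioi (fun x hx => hx.1)
    intro u hu
    have hu1 : 0 < u := hu.1
    have : t < u := by
      by_contra hcon
      exact hu.2 ⟨hu1, not_lt.mp hcon⟩
    rw [hk0' _ (by linarith [hη.1]), mul_zero]
  have main : ∫ ξ in (0:ℝ)..t, deriv w ξ / (t - ξ) ^ α = Real.Gamma (1 - α) * ∫ η in (0:ℝ)..t, kα (t - η) * τ η := by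
    rw [intervalIntegral.integral_of_le ht.le, intervalIntegral.integral_of_le ht.le]
    calc ∫ ξ in Ioc 0 t, deriv w ξ / (t - ξ) ^ α
        = ∫ ξ in Ioc 0 t, ∫ η in Ioc 0 t, ((t - ξ) ^ (-α) * k' (ξ - η)) * τ η := by
          refine setIntegral_congr_fun measurableSet_Ioc fun ξ hξ => ?_
          simp only [mul_assoc]
          rw [integral_const_mul, ← intervalIntegral.integral_of_le ht.le, conv_trunc hk' hk0' hτ hM hξ.2,
            ← hwd ξ hξ.1, Real.rpow_neg (by linarith [hξ.2])]
          ring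
      _ = ∫ η in Ioc 0 t, ∫ ξ in Ioc 0 t, ((t - ξ) ^ (-α) * k' (ξ - η)) * τ η := integral_integral_swap hint
      _ = ∫ η in Ioc 0 t, Real.Gamma (1 - α) * (kα (t - η) * τ η) := by
          refine setIntegral_congr_fun measurableSet_Ioc fun η hη => ?_
          rw [integral_mul_const, inner η hη]; ring
      _ = _ := by rw [integral_const_mul]
  rw [caputoD, main]
  field_simp

/-! ### The real kernel -/

noncomputable def Kr (L : ℂ →L[ℝ] ℝ) (b : ℂ) (ρ σ a : ℝ) (c : ℂ) (μ x t : ℝ) : ℝ :=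
  L (c * Kv b ρ μ (σ * (x - a)) t)

section
variable {b : ℂ} {ρ ε κ : ℝ} (hb : GoodB b ρ ε κ) (L : ℂ →L[ℝ] ℝ) (σ a : ℝ) (c : ℂ)

lemma Kr_cont (hb : GoodB b ρ ε κ) (μ : ℝ) {x : ℝ} (hx : 0 < σ * (x - a)) : Continuous (fun t => Kr L b ρ σ a c μ x t) :=
  L.continuous.comp (continuous_const.mul (Kv_cont hb μ hx))

lemma Kr_zero (hb : GoodB b ρ ε κ) (μ : ℝ) {x : ℝ} (hx : 0 < σ * (x - a)) : ∀ t ≤ 0, Kr L b ρ σ a c μ x t = 0 := by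
  intro t ht
  rw [Kr, Kv_zero hb hx ht]; simp

lemma Kr_dt (hb : GoodB b ρ ε κ) (μ : ℝ) {x : ℝ} (hx : 0 < σ * (x - a)) (t : ℝ) :
    HasDerivAt (fun t => Kr L b ρ σ a c μ x t) (Kr L b ρ σ a c (μ - 1) x t) t :=
  L.hasFDerivAt.comp_hasDerivAt t ((Kv_hasDerivAt_t hb μ hx t).const_mul c)

lemma Kr_dx (hb : GoodB b ρ ε κ) (μ : ℝ) {x : ℝ} (hx : 0 < σ * (x - a)) (t : ℝ) :
    HasDerivAt (fun x => Kr L b ρ σ a c μ x t) (Kr L b ρ σ a (c * (-b * σ)) (μ - ρ) x t) x := by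
  have h1 : HasDerivAt (fun x : ℝ => σ * (x - a)) σ x := by
    simpa using ((hasDerivAt_id x).sub_const a).const_mul σ
  have h2 := ((Kv_hasDerivAt_r hb μ hx t).scomp x h1).const_mul c
  have h3 := L.hasFDerivAt.comp_hasDerivAt x h2
  refine h3.congr_deriv ?_
  rw [Kr]; congr 1
  rw [Complex.real_smul]; ring

lemma Kr_bound (hb : GoodB b ρ ε κ) (μ : ℝ) {r0 : ℝ} (hr0 : 0 < r0) :
    ∃ C, 0 ≤ C ∧ ∀ x, r0 ≤ σ * (x - a) → ∀ t, |Kr L b ρ σ a c μ x t| ≤ C * Real.exp t := by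
  obtain ⟨C, hC, h⟩ := Kv_bound hb μ hr0
  refine ⟨‖L‖ * (‖c‖ * C), by positivity, fun x hx t => ?_⟩
  refine (L.le_opNorm _).trans ?_
  rw [norm_mul, mul_assoc, mul_assoc]
  exact mul_le_mul_of_nonneg_left (mul_le_mul_of_nonneg_left (h _ hx t) (norm_nonneg _)) (norm_nonneg _)

lemma Kr_frac (hb : GoodB b ρ ε κ) (μ : ℝ) {x : ℝ} (hx : 0 < σ * (x - a)) {β : ℝ} (hβ : 0 < β) (v : ℝ) :
    ∫ u in Ioi (0:ℝ), u ^ (β - 1) * Kr L b ρ σ a c μ x (v - u) = Real.Gamma β * Kr L b ρ σ a c (μ + β) x v := by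
  obtain ⟨C, hC, h⟩ := Kv_bound hb μ hx
  have hint : IntegrableOn (fun u : ℝ => c * (((u ^ (β - 1) : ℝ) : ℂ) * Kv b ρ μ (σ * (x - a)) (v - u))) (Ioi 0) := by
    refine Integrable.const_mul ?_ c
    refine ((lap_integrable hβ one_pos).mul_const (C * Real.exp v)).mono' ?_ ?_
    · have m1 : Measurable (fun u : ℝ => ((u ^ (β - 1) : ℝ) : ℂ)) :=
        Complex.measurable_ofReal.comp (measurable_id.pow_const _)
      have m2 : Continuous (fun u : ℝ => Kv b ρ μ (σ * (x - a)) (v - u)) :=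
        (Kv_cont hb μ hx).comp (by fun_prop : Continuous fun u : ℝ => v - u)
      exact (m1.mul m2.measurable).aestronglyMeasurable
    · filter_upwards [ae_restrict_mem measurableSet_Ioi] with u hu
      have hu : 0 < u := hu
      have hp : 0 ≤ u ^ (β - 1) := Real.rpow_nonneg hu.le _
      rw [norm_mul, Complex.norm_real, Real.norm_of_nonneg hp, mul_assoc]
      refine mul_le_mul_of_nonneg_left ((h _ le_rfl _).trans (le_of_eq ?_)) hp
      rw [one_mul, sub_eq_add_neg, Real.exp_add]; ring
  have e : ∀ u : ℝ, u ^ (β - 1) * Kr L b ρ σ a c μ x (v - u)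
      = L (c * (((u ^ (β - 1) : ℝ) : ℂ) * Kv b ρ μ (σ * (x - a)) (v - u))) := by
    intro u
    rw [Kr, ← smul_eq_mul, ← map_smul, Complex.real_smul]
    congr 1; ring
  simp only [e]
  rw [ContinuousLinearMap.integral_comp_comm L hint, integral_const_mul, Kv_frac hb μ hx hβ, Complex.Gamma_ofReal, Kr,
    ← smul_eq_mul (Real.Gamma β), ← map_smul, Complex.real_smul]
  congr 1; ring

lemma conv_dx (hb : GoodB b ρ ε κ) (μ : ℝ) {τ : ℝ → ℝ} (hτ : Measurable τ) {M : ℝ} (hM : ∀ t, |τ t| ≤ M)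
    {x : ℝ} (hx : 0 < σ * (x - a)) {t : ℝ} (ht : 0 < t) :
    HasDerivAt (fun x => ∫ η in (0:ℝ)..t, Kr L b ρ σ a c μ x (t - η) * τ η)
      (∫ η in (0:ℝ)..t, Kr L b ρ σ a (c * (-b * σ)) (μ - ρ) x (t - η) * τ η) x := by
  obtain ⟨C, hC, h⟩ := Kr_bound L σ a (c * (-b * σ)) hb (μ - ρ) (half_pos hx)
  have hnh : {y : ℝ | σ * (x - a) / 2 < σ * (y - a)} ∈ 𝓝 x :=
    (isOpen_lt continuous_const (by fun_prop)).mem_nhds (by simp only [mem_ofPred_eq]; linarith)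
  have hms : ∀ (c' : ℂ) (ν : ℝ) {y : ℝ}, 0 < σ * (y - a) → Measurable (fun η => Kr L b ρ σ a c' ν y (t - η) * τ η) := by
    intro c' ν y hy
    exact ((Kr_cont L σ a c' hb ν hy).comp (by fun_prop : Continuous fun η => t - η)).measurable.mul hτ
  have := intervalIntegral.hasDerivAt_integral_of_dominated_loc_of_deriv_le (μ := volume) (𝕜 := ℝ)
    (F := fun y η => Kr L b ρ σ a c μ y (t - η) * τ η)
    (F' := fun y η => Kr L b ρ σ a (c * (-b * σ)) (μ - ρ) y (t - η) * τ η) (x₀ := x) (a := 0) (b := t)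
    (bound := fun _ => C * Real.exp t * M) hnh
    (by
      filter_upwards [hnh] with y hy
      exact (hms c μ ((half_pos hx).trans hy)).aestronglyMeasurable)
    (ii_conv (Kr_cont L σ a c hb μ hx) hτ hM t 0 t)
    (hms _ _ hx).aestronglyMeasurable
    (ae_of_all _ fun η hη y hy => ?_) intervalIntegrable_const
    (ae_of_all _ fun η hη y hy => ?_)
  · exact this.2
  · rw [uIoc_of_le ht.le] at hη
    rw [norm_mul]
    refine mul_le_mul ((h y (le_of_lt hy) _).trans ?_) (hM η) (norm_nonneg _) (by positivity)
    exact mul_le_mul_of_nonneg_left (Real.exp_le_exp.mpr (by linarith [hη.1])) hC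
  · exact (Kr_dx L σ a c hb μ ((half_pos hx).trans hy) _).mul_const _

end

theorem core {α : ℝ} (hα0 : 0 < α) (hα1 : α < 1) {b : ℂ} {ρ ε κ : ℝ} (hb : GoodB b ρ ε κ) (hρ : α = 3 * ρ)
    (L : ℂ →L[ℝ] ℝ) (σ a μ : ℝ) (h3 : (-b * σ)^3 = 1)
    {τ : ℝ → ℝ} (hτ : Measurable τ) {M : ℝ} (hM : ∀ t, |τ t| ≤ M) (w : ℝ → ℝ → ℝ)
    (hw : ∀ x, 0 < σ * (x - a) → ∀ t, 0 < t → w x t = ∫ η in (0:ℝ)..t, Kr L b ρ σ a 1 μ x (t - η) * τ η)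
    {x : ℝ} (hx : 0 < σ * (x - a)) :
    (∀ t, 0 < t → caputoD α (fun s => w x s) t - deriv (deriv (deriv (fun y => w y t))) x = 0) ∧
    Tendsto (fun t => w x t) (𝓝[>] 0) (𝓝 0) := by
  have hM0 : 0 ≤ M := (abs_nonneg _).trans (hM 0)
  constructor
  · intro t ht
    have hcap := conv_caputo hα0 hα1 (Kr_cont L σ a 1 hb μ hx) (Kr_cont L σ a 1 hb (μ-1) hx)
      (Kr_zero L σ a 1 hb μ hx) (Kr_zero L σ a 1 hb (μ-1) hx) (Kr_dt L σ a 1 hb μ hx)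
      (kα := fun v => Kr L b ρ σ a 1 (μ - 1 + (1 - α)) x v)
      (fun v => by
        have := Kr_frac L σ a 1 hb (μ-1) hx (β := 1 - α) (by linarith) v
        rw [show 1 - α - 1 = -α by ring] at this
        exact this) hτ hM (w := fun s => w x s) (fun s hs => hw x hx s hs) ht
    rw [hcap]
    have hU : IsOpen {y : ℝ | 0 < σ * (y - a)} := isOpen_lt continuous_const (by fun_prop)
    have d1 : ∀ y, 0 < σ * (y - a) → deriv (fun y => w y t) y =
        ∫ η in (0:ℝ)..t, Kr L b ρ σ a (1 * (-b * σ)) (μ - ρ) y (t - η) * τ η := by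
      intro y hy
      refine ((conv_dx L σ a 1 hb μ hτ hM hy ht).congr_of_eventuallyEq ?_).deriv
      filter_upwards [hU.mem_nhds hy] with z hz
      exact hw z hz t ht
    have d2 : ∀ y, 0 < σ * (y - a) → deriv (deriv (fun y => w y t)) y =
        ∫ η in (0:ℝ)..t, Kr L b ρ σ a (1 * (-b * σ) * (-b * σ)) (μ - ρ - ρ) y (t - η) * τ η := by
      intro y hy
      refine ((conv_dx L σ a _ hb (μ - ρ) hτ hM hy ht).congr_of_eventuallyEq ?_).deriv
      filter_upwards [hU.mem_nhds hy] with z hz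
      exact d1 z hz
    have d3 : deriv (deriv (deriv (fun y => w y t))) x =
        ∫ η in (0:ℝ)..t, Kr L b ρ σ a (1 * (-b * σ) * (-b * σ) * (-b * σ)) (μ - ρ - ρ - ρ) x (t - η) * τ η := by
      refine ((conv_dx L σ a _ hb (μ - ρ - ρ) hτ hM hx ht).congr_of_eventuallyEq ?_).deriv
      filter_upwards [hU.mem_nhds hx] with z hz
      exact d2 z hz
    rw [d3, show (1 * (-b * σ) * (-b * σ) * (-b * σ) : ℂ) = 1 by linear_combination h3,
      show μ - ρ - ρ - ρ = μ - 1 + (1 - α) by rw [hρ]; ring, sub_self]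
  · obtain ⟨C, hC, h⟩ := Kr_bound L σ a 1 hb μ hx
    have hlim : Tendsto (fun t : ℝ => C * Real.exp t * M * |t - 0|) (𝓝[>] 0) (𝓝 0) := by
      have : Continuous (fun t : ℝ => C * Real.exp t * M * |t - 0|) := by fun_prop
      have h0 := this.tendsto 0
      simp only [sub_zero, abs_zero, mul_zero] at h0
      simpa using h0.mono_left nhdsWithin_le_nhds
    refine squeeze_zero_norm' ?_ hlim
    filter_upwards [self_mem_nhdsWithin] with t ht
    have ht : 0 < t := ht
    rw [hw x hx t ht]
    refine intervalIntegral.norm_integral_le_of_norm_le_const fun η hη => ?_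
    rw [uIoc_of_le ht.le] at hη
    rw [norm_mul]
    refine mul_le_mul ((h x le_rfl _).trans ?_) (hM η) (norm_nonneg _) (by positivity)
    exact mul_le_mul_of_nonneg_left (Real.exp_le_exp.mpr (by linarith [hη.1])) hC


lemma tau_ext {τ : ℝ → ℝ} (hc : ContinuousOn τ (Ioi 0)) (hb : ∃ M, ∀ t ∈ Ioi (0:ℝ), |τ t| ≤ M) :
    ∃ τ' : ℝ → ℝ, ∃ M, Measurable τ' ∧ (∀ t, |τ' t| ≤ M) ∧ ∀ t, 0 < t → τ' t = τ t := by
  classical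
  obtain ⟨M, hM⟩ := hb
  refine ⟨(Ioi (0:ℝ)).piecewise τ (fun _ => 0), M, hc.measurable_piecewise continuousOn_const measurableSet_Ioi, ?_, ?_⟩
  · intro t
    by_cases ht : t ∈ Ioi (0:ℝ)
    · rw [piecewise_eq_of_mem _ _ _ ht]; exact hM t ht
    · rw [piecewise_eq_of_notMem _ _ _ ht, abs_zero]
      exact (abs_nonneg _).trans (hM 1 (by norm_num))
  · intro t ht
    exact piecewise_eq_of_mem _ _ _ ht

lemma conv_congr {f g τ τ' : ℝ → ℝ} {t : ℝ} (ht : 0 < t) (hfg : ∀ s, 0 < s → f s = g s)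
    (hττ : ∀ s, 0 < s → τ' s = τ s) :
    ∫ η in (0:ℝ)..t, f (t - η) * τ η = ∫ η in (0:ℝ)..t, g (t - η) * τ' η := by
  rw [intervalIntegral.integral_of_le ht.le, intervalIntegral.integral_of_le ht.le,
    integral_Ioc_eq_integral_Ioo, integral_Ioc_eq_integral_Ioo]
  refine setIntegral_congr_fun measurableSet_Ioo fun η hη => ?_
  rw [hfg _ (by linarith [hη.2]), hττ _ hη.1]

lemma e23_eq : -e23 = Complex.exp (((-(π/3) : ℝ) : ℂ) * Complex.I) := by
  have h : e23 = Complex.exp (((-(π/3) : ℝ) : ℂ) * Complex.I) * Complex.exp (π * Complex.I) := by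
    rw [e23, ← Complex.exp_add]; congr 1; push_cast; ring
  rw [h, Complex.exp_pi_mul_I]; ring

lemma e23_cube : e23 ^ 3 = 1 := by
  rw [e23, ← Complex.exp_nat_mul, ← Complex.exp_two_pi_mul_I]
  congr 1; push_cast; ring

noncomputable def Lg : ℂ →L[ℝ] ℝ := (1/3 : ℝ) • Complex.reCLM
noncomputable def Lpos : ℂ →L[ℝ] ℝ :=
  (-(2/3) : ℝ) • (Complex.reCLM.comp (ContinuousLinearMap.mul ℝ ℂ e23))
noncomputable def Lv : ℂ →L[ℝ] ℝ :=
  (1/3 : ℝ) • (Complex.imCLM.comp (ContinuousLinearMap.mul ℝ ℂ e23))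

lemma G_neg {α μ ε κ a x t : ℝ} (hb : GoodB 1 (α/3) ε κ) (hx : x < a) (ht : 0 < t) :
    Gfun α μ (x - a) t = Kr Lg 1 (α/3) (-1) a 1 μ x t := by
  rw [Kr, Kv_eq_wright hb (by linarith) ht, Gfun, if_pos (by linarith), one_mul]
  have e : (-1 : ℂ) * ((-1 * (x - a) / t ^ (α/3) : ℝ) : ℂ) = (((x - a) / t ^ (α/3) : ℝ) : ℂ) := by
    push_cast; ring
  rw [e, ← Complex.real_smul, map_smul]
  simp [Lg]
  ring

lemma G_pos {α μ ε κ a x t : ℝ} (hb : GoodB (-e23) (α/3) ε κ) (hx : a < x) (ht : 0 < t) :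
    Gfun α μ (x - a) t = Kr Lpos (-e23) (α/3) 1 a 1 μ x t := by
  rw [Kr, Kv_eq_wright hb (by linarith) ht, Gfun, if_neg (by linarith), one_mul, neg_neg, one_mul,
    ← Complex.real_smul, map_smul, Complex.ofReal_div α 3]
  simp only [Lpos, _root_.smul_apply, ContinuousLinearMap.comp_apply, ContinuousLinearMap.mul_apply',
    Complex.reCLM_apply, smul_eq_mul, Complex.ofReal_ofNat]
  ring

lemma V_pos {α μ ε κ a x t : ℝ} (hb : GoodB (-e23) (α/3) ε κ) (hx : a < x) (ht : 0 < t) :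
    Vfun α μ (x - a) t = Kr Lv (-e23) (α/3) 1 a 1 μ x t := by
  rw [Kr, Kv_eq_wright hb (by linarith) ht, Vfun, one_mul, neg_neg, one_mul,
    ← Complex.real_smul, map_smul, Complex.ofReal_div α 3]
  simp only [Lv, _root_.smul_apply, ContinuousLinearMap.comp_apply, ContinuousLinearMap.mul_apply',
    Complex.imCLM_apply, smul_eq_mul, Complex.ofReal_ofNat]
  ring


/-- **Lemma 1.** The single-layer potentials
`w₁(x,t) = ∫₀ᵗ G_α^{2α/3}(x−a, t−η) τ₁(η) dη` and
`w₂(x,t) = ∫₀ᵗ V_α^{2α/3}(x−a, t−η) τ₂(η) dη`, built with continuous bounded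
densities, solve the homogeneous time-fractional Airy equation away from `x = a`
and vanish as `t → 0⁺`. -/
theorem potentials_w1_w2_properties
    (α : ℝ) (hα0 : 0 < α) (hα1 : α < 1) (a : ℝ) (τ₁ τ₂ : ℝ → ℝ)
    (hτ₁c : ContinuousOn τ₁ (Set.Ioi 0)) (hτ₂c : ContinuousOn τ₂ (Set.Ioi 0))
    (hτ₁b : ∃ M, ∀ t ∈ Set.Ioi (0:ℝ), |τ₁ t| ≤ M)
    (hτ₂b : ∃ M, ∀ t ∈ Set.Ioi (0:ℝ), |τ₂ t| ≤ M)
    (w₁ w₂ : ℝ → ℝ → ℝ)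
    (hw₁ : ∀ x t, w₁ x t = ∫ η in (0:ℝ)..t, Gfun α (2*α/3) (x - a) (t - η) * τ₁ η)
    (hw₂ : ∀ x t, w₂ x t = ∫ η in (0:ℝ)..t, Vfun α (2*α/3) (x - a) (t - η) * τ₂ η) :
    (∀ x, x ≠ a → ∀ t, 0 < t →
      caputoD α (fun s => w₁ x s) t - deriv (deriv (deriv (fun y => w₁ y t))) x = 0) ∧
    (∀ x, a < x → ∀ t, 0 < t →
      caputoD α (fun s => w₂ x s) t - deriv (deriv (deriv (fun y => w₂ y t))) x = 0) ∧
    (∀ x, x ≠ a → Filter.Tendsto (fun t => w₁ x t) (nhdsWithin 0 (Set.Ioi 0)) (nhds 0)) ∧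
    (∀ x, a < x → Filter.Tendsto (fun t => w₂ x t) (nhdsWithin 0 (Set.Ioi 0)) (nhds 0)) := by

  obtain ⟨T₁, M₁, hm₁, hM₁, hT₁⟩ := tau_ext hτ₁c hτ₁b
  obtain ⟨T₂, M₂, hm₂, hM₂, hT₂⟩ := tau_ext hτ₂c hτ₂b
  have hρ : α = 3 * (α/3) := by ring
  obtain ⟨ε₁, κ₁, hb₁⟩ := goodB_exists 0 (α/3) (by rw [abs_zero]; positivity) (by linarith) (by linarith)
  rw [Complex.ofReal_zero, zero_mul, Complex.exp_zero] at hb₁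
  obtain ⟨ε₂, κ₂, hb₂⟩ := goodB_exists (-(π/3)) (α/3) (by rw [abs_neg, abs_of_pos (by positivity)])
    (by linarith) (by linarith)
  rw [← e23_eq] at hb₂
  have c1 : (-(1:ℂ) * ((-1 : ℝ) : ℂ))^3 = 1 := by push_cast; ring
  have c2 : (-(-e23) * ((1 : ℝ) : ℂ))^3 = 1 := by
    rw [neg_neg, Complex.ofReal_one, mul_one, e23_cube]
  have A := fun x (hx : x < a) => core hα0 hα1 hb₁ hρ Lg (-1) a (2*α/3) c1 hm₁ hM₁ w₁
    (fun x hx t ht => by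
      rw [hw₁]
      exact conv_congr (f := fun s => Gfun α (2*α/3) (x - a) s) ht
        (fun s hs => G_neg hb₁ (by linarith) hs) hT₁) (x := x) (by linarith)
  have B := fun x (hx : a < x) => core hα0 hα1 hb₂ hρ Lpos 1 a (2*α/3) c2 hm₁ hM₁ w₁
    (fun x hx t ht => by
      rw [hw₁]
      exact conv_congr (f := fun s => Gfun α (2*α/3) (x - a) s) ht
        (fun s hs => G_pos hb₂ (by linarith) hs) hT₁) (x := x) (by linarith)
  have D := fun x (hx : a < x) => core hα0 hα1 hb₂ hρ Lv 1 a (2*α/3) c2 hm₂ hM₂ w₂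
    (fun x hx t ht => by
      rw [hw₂]
      exact conv_congr (f := fun s => Vfun α (2*α/3) (x - a) s) ht
        (fun s hs => V_pos hb₂ (by linarith) hs) hT₂) (x := x) (by linarith)
  refine ⟨fun x hx => ?_, fun x hx => (D x hx).1, fun x hx => ?_, fun x hx => (D x hx).2⟩
  · rcases lt_or_gt_of_ne hx with h | h
    · exact (A x h).1
    · exact (B x h).1
  · rcases lt_or_gt_of_ne hx with h | h
    · exact (A x h).2
    · exact (B x h).2
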